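/- Let n ≥ 3 and let a ≥ 1/(n-2). Then for every u ∈ C_c^∞(B_1), ∫_{B_1} |∇u|² dx ≥ ((n-2)/2)² ∫_{B_1} u²/|x|² dx + (n-2)^{-2(n-1)/n} S_n · ( ∫_{B_1} X_1(a,|x|)^{2(n-1)/(n-2)} |u|^{2n/(n-2)} dx )^{(n-2)/n}. -/

import Mathlib

open MeasureTheory Real

/-- The best Sobolev constant `S_n = π n (n-2) (Γ(n/2)/Γ(n))^(2/n)`. -/
noncomputable def sobolevConst (n : ℕ) : ℝ :=
  Real.pi * n * ((n : ℝ) - 2) * (Real.Gamma ((n : ℝ) / 2) / Real.Gamma (n : ℝ)) ^ (2 / (n : ℝ))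

/-- `X_1(a,s) = (a - ln s)⁻¹`. -/
noncomputable def X1 (a s : ℝ) : ℝ := (a - Real.log s)⁻¹

section Helpers

open Set Filter Topology

theorem exists_monotone_transport {Λ : Type} [TopologicalSpace Λ] [FirstCountableTopology Λ]
    {R : ℝ} (hR : 0 < R) {F G : Λ → ℝ → ℝ}
    (hF : Continuous (Function.uncurry F)) (hG : Continuous (Function.uncurry G))
    (hF0 : ∀ l x, 0 < F l x) (hG0 : ∀ l x, 0 < G l x)
    (hFG : ∀ l, ∫ x in (-R)..R, F l x = ∫ x in (-R)..R, G l x) :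
    ∃ T D : Λ → ℝ → ℝ, Continuous (Function.uncurry T) ∧ Continuous (Function.uncurry D) ∧
      (∀ l x, HasDerivAt (T l) (D l x) x) ∧ (∀ l x, 0 < D l x) ∧
      (∀ l, T l (-R) = -R) ∧ (∀ l, T l R = R) ∧
      (∀ l, ∀ x ∈ Icc (-R) R, T l x ∈ Icc (-R) R) ∧
      (∀ l, ∀ x ∈ Icc (-R) R, D l x * G l (T l x) = F l x) := by
  set g : Λ → ℝ → ℝ := fun l y => G l (max (-R) (min y R)) with hg
  have hgc : Continuous (Function.uncurry g) := by
    have : Function.uncurry g = fun p : Λ × ℝ => Function.uncurry G (p.1, max (-R) (min p.2 R)) :=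
      rfl
    rw [this]; fun_prop
  have hgl : ∀ l, Continuous (g l) := fun l => hgc.comp (Continuous.prodMk_right l)
  have hFl : ∀ l, Continuous (F l) := fun l => hF.comp (Continuous.prodMk_right l)
  have hgG : ∀ l, ∀ y ∈ Icc (-R) R, g l y = G l y := by
    intro l y hy
    simp only [hg]
    rw [min_eq_left hy.2, max_eq_right hy.1]
  set P : Λ → ℝ → ℝ := fun l y => ∫ t in (-R)..y, g l t with hP
  set Q : Λ → ℝ → ℝ := fun l y => ∫ t in (-R)..y, F l t with hQ
  have hPc : Continuous (Function.uncurry P) :=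
    intervalIntegral.continuous_parametric_primitive_of_continuous hgc
  have hQc : Continuous (Function.uncurry Q) :=
    intervalIntegral.continuous_parametric_primitive_of_continuous hF
  have hPd : ∀ l y, HasDerivAt (P l) (g l y) y := fun l y =>
    (hgl l).integral_hasStrictDerivAt _ _ |>.hasDerivAt
  have hQd : ∀ l y, HasDerivAt (Q l) (F l y) y := fun l y =>
    (hFl l).integral_hasStrictDerivAt _ _ |>.hasDerivAt
  have hPl : ∀ l, Continuous (P l) := fun l => hPc.comp (Continuous.prodMk_right l)
  have hPm : ∀ l, StrictMono (P l) := fun l =>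
    strictMono_of_deriv_pos fun y => by rw [(hPd l y).deriv]; exact hG0 _ _
  have hQm : ∀ l, StrictMono (Q l) := fun l =>
    strictMono_of_deriv_pos fun y => by rw [(hQd l y).deriv]; exact hF0 _ _
  have hPs : ∀ l, Function.Surjective (P l) := by
    intro l
    obtain ⟨y0, -, hy0⟩ := isCompact_Icc.exists_isMinOn (nonempty_Icc.2 (by linarith : -R ≤ R))
      ((hG.comp (Continuous.prodMk_right l)).continuousOn)
    have hb : ∀ y, G l y0 ≤ g l y := fun y =>
      hy0 (show max (-R) (min y R) ∈ Icc (-R) R from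
        ⟨le_max_left _ _, max_le (by linarith) (min_le_right _ _)⟩)
    have hmono : Monotone (fun y => P l y - G l y0 * y) := by
      have hd : ∀ y, HasDerivAt (fun y => P l y - G l y0 * y) (g l y - G l y0) y := fun y => by
        simpa using (hPd l y).fun_sub ((hasDerivAt_id' y).const_mul (G l y0))
      refine monotone_of_deriv_nonneg (fun y => (hd y).differentiableAt) fun y => ?_
      rw [(hd y).deriv]
      exact sub_nonneg.2 (hb y)
    refine (hPl l).surjective ?_ ?_
    · refine tendsto_atTop_mono' _ (f₁ := fun y => G l y0 * y + (P l 0)) ?_ ?_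
      · filter_upwards [eventually_ge_atTop 0] with y hy
        have := hmono hy
        simp only [mul_zero, sub_zero] at this; linarith
      · exact tendsto_atTop_add_const_right _ _ (tendsto_id.const_mul_atTop (hG0 _ _))
    · refine tendsto_atBot_mono' _ (f₁ := fun y => G l y0 * y + (P l 0)) ?_ ?_
      · filter_upwards [eventually_le_atBot 0] with y hy
        have := hmono hy
        simp only [mul_zero, sub_zero] at this; linarith
      · exact tendsto_atBot_add_const_right _ _ (tendsto_id.const_mul_atBot (hG0 _ _))
  choose S hS using hPs
  have hSc : Continuous (Function.uncurry S) := by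
    rw [continuous_iff_lower_upperSemicontinuous, lowerSemicontinuous_iff_isOpen_preimage,
      upperSemicontinuous_iff_isOpen_preimage]
    constructor
    · intro c
      have : Function.uncurry S ⁻¹' Ioi c = {p : Λ × ℝ | P p.1 c < p.2} := by
        ext ⟨l, s⟩
        simp only [mem_preimage, mem_Ioi, Function.uncurry, mem_ofPred_eq]
        rw [← (hPm l).lt_iff_lt, hS]
      rw [this]
      exact isOpen_lt (hPc.comp (f := fun p : Λ × ℝ => (p.1, c)) (by fun_prop)) continuous_snd
    · intro c
      have : Function.uncurry S ⁻¹' Iio c = {p : Λ × ℝ | p.2 < P p.1 c} := by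
        ext ⟨l, s⟩
        simp only [mem_preimage, mem_Iio, Function.uncurry, mem_ofPred_eq]
        rw [← (hPm l).lt_iff_lt, hS]
      rw [this]
      exact isOpen_lt continuous_snd (hPc.comp (f := fun p : Λ × ℝ => (p.1, c)) (by fun_prop))
  have hSP : ∀ l y, S l (P l y) = y := fun l y => (hPm l).injective (hS l _)
  have hTc : Continuous (Function.uncurry fun l x => S l (Q l x)) :=
    hSc.comp (f := fun p : Λ × ℝ => (p.1, Q p.1 p.2)) (continuous_fst.prodMk hQc)
  have hg0 : ∀ l y, 0 < g l y := fun l y => hG0 _ _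
  have hSm : ∀ l, StrictMono (S l) := fun l s t hst => by
    rw [← (hPm l).lt_iff_lt, hS, hS]; exact hst
  have hT1 : ∀ l, S l (Q l (-R)) = -R := fun l => by
    have : Q l (-R) = P l (-R) := by simp [hP, hQ]
    rw [this, hSP]
  have hT2 : ∀ l, S l (Q l R) = R := fun l => by
    have : Q l R = P l R := by
      simp only [hP, hQ, hFG]
      refine intervalIntegral.integral_congr fun y hy => ?_
      rw [uIcc_of_le (by linarith)] at hy
      exact (hgG l y hy).symm
    rw [this, hSP]
  have hT3 : ∀ l, ∀ x ∈ Icc (-R) R, S l (Q l x) ∈ Icc (-R) R := fun l x hx => by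
    constructor
    · conv_lhs => rw [← hT1 l]
      exact ((hSm l).comp (hQm l)).monotone hx.1
    · conv_rhs => rw [← hT2 l]
      exact ((hSm l).comp (hQm l)).monotone hx.2
  refine ⟨fun l x => S l (Q l x), fun l x => F l x / g l (S l (Q l x)), hTc, ?_, ?_, ?_, hT1, hT2,
    hT3, ?_⟩
  · exact hF.div (hgc.comp (f := fun p : Λ × ℝ => (p.1, S p.1 (Q p.1 p.2)))
      (continuous_fst.prodMk hTc))
      fun p => (hg0 _ _).ne'
  · intro l x
    have h1 : HasDerivAt (S l) (g l (S l (Q l x)))⁻¹ (Q l x) :=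
      HasDerivAt.of_local_left_inverse (hSc.comp (Continuous.prodMk_right l)).continuousAt
        (hPd l _) (hg0 _ _).ne' (Eventually.of_forall (hS l))
    exact (h1.comp x (hQd l x)).congr_deriv (div_eq_inv_mul _ _).symm
  · intro l x
    exact div_pos (hF0 _ _) (hg0 _ _)
  · intro l x hx
    simp only
    rw [hgG l _ (hT3 l x hx), div_mul_cancel₀ _ (hG0 _ _).ne']

theorem integral_comp_of_monotone_transport {R : ℝ} (hR : 0 < R) {F G T D φ : ℝ → ℝ}
    (hG : Continuous G) (hφ : Continuous φ) (hD : Continuous D) (hTD : ∀ x, HasDerivAt T (D x) x)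
    (hT1 : T (-R) = -R) (hT2 : T R = R) (h : ∀ x ∈ Icc (-R) R, D x * G (T x) = F x) :
    ∫ x in (-R)..R, F x * φ (T x) = ∫ x in (-R)..R, G x * φ x := by
  have := intervalIntegral.integral_comp_mul_deriv (a := -R) (b := R) (f := T) (f' := D)
    (g := fun y => G y * φ y) (fun x _ => hTD x) hD.continuousOn (hG.mul hφ)
  rw [hT1, hT2] at this
  rw [← this]
  refine intervalIntegral.integral_congr fun x hx => ?_
  rw [uIcc_of_le (by linarith)] at hx
  simp only [Function.comp]
  rw [← h x hx]; ring

theorem setIntegral_box_insertNth {n : ℕ} {R : ℝ} (hR : 0 < R) (i : Fin (n + 1))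
    {f : (Fin (n + 1) → ℝ) → ℝ} (hf : Continuous f) :
    ∫ x in Icc (fun _ => -R) (fun _ => R), f x =
      ∫ t in (-R)..R, ∫ y in Icc (fun _ => -R) (fun _ => R), f (i.insertNth t y) := by
  set e : ℝ × (Fin n → ℝ) ≃ᵐ (Fin (n + 1) → ℝ) :=
    (MeasurableEquiv.piFinSuccAbove (fun _ => ℝ) i).symm
  have hem : MeasurePreserving e :=
    (volume_preserving_piFinSuccAbove (fun _ : Fin (n + 1) => ℝ) i).symm _
  have heq : (e ⁻¹' Icc (fun _ => -R) fun _ => R) =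
      Icc (-R) R ×ˢ Icc (fun _ => -R) fun _ => R :=
    ((Fin.insertNthOrderIso (fun _ => ℝ) i).preimage_Icc _ _).trans (Icc_prod_eq _ _)
  have hfi : IntegrableOn f (Icc (fun _ => -R) fun _ => R) := hf.continuousOn.integrableOn_Icc
  rw [intervalIntegral.integral_of_le (by linarith), ← integral_Icc_eq_integral_Ioc,
    ← hem.map_eq, setIntegral_map_equiv, heq, Measure.volume_eq_prod, setIntegral_prod]
  · rfl
  · rwa [← hem.integrableOn_comp_preimage e.measurableEmbedding, heq] at hfi

theorem setIntegral_box_insertNth_swap {n : ℕ} {R : ℝ} (hR : 0 < R) (i : Fin (n + 1))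
    {f : (Fin (n + 1) → ℝ) → ℝ} (hf : Continuous f) :
    ∫ x in Icc (fun _ => -R) (fun _ => R), f x =
      ∫ y in Icc (fun _ => -R) (fun _ => R), ∫ t in (-R)..R, f (i.insertNth t y) := by
  rw [setIntegral_box_insertNth hR i hf, intervalIntegral.integral_of_le (by linarith)]
  simp_rw [intervalIntegral.integral_of_le (show -R ≤ R by linarith)]
  refine integral_integral_swap ?_
  rw [Measure.prod_restrict]
  refine (Continuous.integrableOn_Icc (a := ((-R, fun _ => -R) : ℝ × (Fin n → ℝ)))
    (b := (R, fun _ => R)) ?_).mono_set ?_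
  · exact hf.comp (Continuous.finInsertNth i continuous_fst continuous_snd)
  · rw [← Icc_prod_Icc]
    exact prod_mono Ioc_subset_Icc_self Subset.rfl

theorem setIntegral_box_pos {n : ℕ} {R : ℝ} (hR : 0 < R) {f : (Fin n → ℝ) → ℝ}
    (hf : Continuous f) (h0 : ∀ x, 0 < f x) :
    0 < ∫ x in Icc (fun _ => -R) (fun _ => R), f x := by
  rw [setIntegral_pos_iff_support_of_nonneg_ae (Eventually.of_forall fun x => (h0 x).le)
    hf.continuousOn.integrableOn_Icc]
  have : Function.support f = univ := eq_univ_of_forall fun x => (h0 x).ne'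
  rw [this, univ_inter, Real.volume_Icc_pi]
  simp only [sub_neg_eq_add, Finset.prod_const]
  exact ENNReal.pow_pos (by simpa using hR) _

theorem setIntegral_box_zero (R : ℝ) (f : (Fin 0 → ℝ) → ℝ) :
    ∫ x in Icc (fun _ => -R) (fun _ => R), f x = f (fun _ => 0) := by
  have : f = fun _ => f (fun _ => 0) := by
    ext x; congr 1; exact Subsingleton.elim _ _
  rw [this, setIntegral_const]
  simp [Measure.real]

theorem exists_knothe_map (n : ℕ) {R : ℝ} (hR : 0 < R) :
    ∀ {Λ : Type} [TopologicalSpace Λ] [FirstCountableTopology Λ] [LocallyCompactSpace Λ]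
    {F G : Λ → (Fin n → ℝ) → ℝ}
    (_ : Continuous (Function.uncurry F)) (_ : Continuous (Function.uncurry G))
    (_ : ∀ l x, 0 < F l x) (_ : ∀ l x, 0 < G l x)
    (_ : ∀ l, ∫ x in Icc (fun _ => -R) (fun _ => R), F l x =
      ∫ x in Icc (fun _ => -R) (fun _ => R), G l x),
    ∃ T D : Λ → (Fin n → ℝ) → (Fin n → ℝ), Continuous (Function.uncurry T) ∧
      Continuous (Function.uncurry D) ∧
      (∀ l x i, HasDerivAt (fun s => T l (Function.update x i s) i) (D l x i) (x i)) ∧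
      (∀ l x i, 0 < D l x i) ∧
      (∀ l, ∀ x ∈ Icc (fun _ => -R) (fun _ => R), T l x ∈ Icc (fun _ => -R) (fun _ => R)) ∧
      (∀ l, ∀ x ∈ Icc (fun _ => -R) (fun _ => R), (∏ i, D l x i) * G l (T l x) = F l x) ∧
      (∀ l (φ : (Fin n → ℝ) → ℝ), Continuous φ →
        ∫ x in Icc (fun _ => -R) (fun _ => R), F l x * φ (T l x) =
          ∫ x in Icc (fun _ => -R) (fun _ => R), G l x * φ x) := by
  induction n with
  | zero =>
    intro Λ _ _ _ F G hF hG hF0 hG0 hFG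
    refine ⟨fun _ x => x, fun _ _ => 0, continuous_snd, continuous_const, fun _ _ i => i.elim0,
      fun _ _ i => i.elim0, fun _ _ h => h, fun l x _ => ?_, fun l φ _ => ?_⟩
    · have := hFG l
      rw [setIntegral_box_zero, setIntegral_box_zero] at this
      rw [Subsingleton.elim x (fun _ => 0), this]; simp
    · have := hFG l
      rw [setIntegral_box_zero, setIntegral_box_zero] at this ⊢
      rw [this]
  | succ n ih =>
    intro Λ _ _ _ F G hF hG hF0 hG0 hFG
    have hB : IsCompact (Icc (fun _ : Fin n => -R) (fun _ => R)) := isCompact_Icc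
    have hcons : ∀ {X : Type} [TopologicalSpace X] {f : X → ℝ} {g : X → Fin n → ℝ},
        Continuous f → Continuous g →
        Continuous (fun p => (Fin.cons (f p) (g p) : Fin (n + 1) → ℝ)) := fun hf hg =>
      Continuous.finCons hf hg
    have hFc : Continuous (fun p : (Λ × ℝ) × (Fin n → ℝ) =>
        F p.1.1 (Fin.cons p.1.2 p.2 : Fin (n + 1) → ℝ)) :=
      hF.comp (f := fun p : (Λ × ℝ) × (Fin n → ℝ) =>
        (p.1.1, (Fin.cons p.1.2 p.2 : Fin (n + 1) → ℝ)))
        ((by fun_prop : Continuous fun p : (Λ × ℝ) × (Fin n → ℝ) => p.1.1).prodMk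
          (hcons (by fun_prop) (by fun_prop)))
    have hGc : Continuous (fun p : (Λ × ℝ) × (Fin n → ℝ) =>
        G p.1.1 (Fin.cons p.1.2 p.2 : Fin (n + 1) → ℝ)) :=
      hG.comp (f := fun p : (Λ × ℝ) × (Fin n → ℝ) =>
        (p.1.1, (Fin.cons p.1.2 p.2 : Fin (n + 1) → ℝ)))
        ((by fun_prop : Continuous fun p : (Λ × ℝ) × (Fin n → ℝ) => p.1.1).prodMk
          (hcons (by fun_prop) (by fun_prop)))
    set F1 : Λ → ℝ → ℝ := fun l t => ∫ y in Icc (fun _ => -R) (fun _ => R),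
      F l (Fin.cons t y : Fin (n + 1) → ℝ) with hF1
    set G1 : Λ → ℝ → ℝ := fun l t => ∫ y in Icc (fun _ => -R) (fun _ => R),
      G l (Fin.cons t y : Fin (n + 1) → ℝ) with hG1
    have hF1c : Continuous (Function.uncurry F1) :=
      continuous_parametric_integral_of_continuous (X := Λ × ℝ) (μ := volume)
        (f := fun p y => F p.1 (Fin.cons p.2 y : Fin (n + 1) → ℝ)) hFc hB
    have hG1c : Continuous (Function.uncurry G1) :=
      continuous_parametric_integral_of_continuous (X := Λ × ℝ) (μ := volume)
        (f := fun p y => G p.1 (Fin.cons p.2 y : Fin (n + 1) → ℝ)) hGc hB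
    have hF10 : ∀ l t, 0 < F1 l t := fun l t =>
      setIntegral_box_pos hR (hFc.comp (Continuous.prodMk_right (l, t))) fun _ => hF0 _ _
    have hG10 : ∀ l t, 0 < G1 l t := fun l t =>
      setIntegral_box_pos hR (hGc.comp (Continuous.prodMk_right (l, t))) fun _ => hG0 _ _
    have hFl : ∀ l, Continuous (F l) := fun l => hF.comp (Continuous.prodMk_right l)
    have hGl : ∀ l, Continuous (G l) := fun l => hG.comp (Continuous.prodMk_right l)
    have fub : ∀ f : (Fin (n + 1) → ℝ) → ℝ, Continuous f →
        ∫ x in Icc (fun _ => -R) (fun _ => R), f x = ∫ t in (-R)..R,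
          ∫ y in Icc (fun _ => -R) (fun _ => R), f (Fin.cons t y) := fun f hf => by
      simpa using setIntegral_box_insertNth hR 0 hf
    obtain ⟨T1, D1, hT1c, hD1c, hTD1, hD10, hT1m, hT1p, hT1b, hDG1⟩ :=
      exists_monotone_transport hR hF1c hG1c hF10 hG10 (fun l => by
        have := hFG l
        rwa [fub _ (hFl l), fub _ (hGl l)] at this)
    have hG'c : Continuous (fun p : (Λ × ℝ) × (Fin n → ℝ) =>
        G p.1.1 (Fin.cons (T1 p.1.1 p.1.2) p.2 : Fin (n + 1) → ℝ)) :=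
      hG.comp (f := fun p : (Λ × ℝ) × (Fin n → ℝ) =>
        (p.1.1, (Fin.cons (T1 p.1.1 p.1.2) p.2 : Fin (n + 1) → ℝ)))
        ((by fun_prop : Continuous fun p : (Λ × ℝ) × (Fin n → ℝ) => p.1.1).prodMk
          (hcons (hT1c.comp continuous_fst) (by fun_prop)))
    have hG1T : Continuous (fun p : Λ × ℝ => G1 p.1 (T1 p.1 p.2)) :=
      hG1c.comp (f := fun p : Λ × ℝ => (p.1, T1 p.1 p.2)) (continuous_fst.prodMk hT1c)
    obtain ⟨T', D', hTc, hDc, hTD, hD0, hTb, hDG, hφ⟩ := ih (Λ := Λ × ℝ)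
      (F := fun p y => F p.1 (Fin.cons p.2 y : Fin (n + 1) → ℝ) / F1 p.1 p.2)
      (G := fun p y => G p.1 (Fin.cons (T1 p.1 p.2) y : Fin (n + 1) → ℝ) / G1 p.1 (T1 p.1 p.2))
      (hFc.div (hF1c.comp continuous_fst) fun p => (hF10 _ _).ne')
      (hG'c.div (hG1T.comp continuous_fst) fun p => (hG10 _ _).ne')
      (fun p x => div_pos (hF0 _ _) (hF10 _ _)) (fun p x => div_pos (hG0 _ _) (hG10 _ _))
      (fun p => by
        rw [integral_div, integral_div, div_self (hF10 _ _).ne', div_self (hG10 _ _).ne'])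
    have hx0 : Continuous fun p : Λ × (Fin (n + 1) → ℝ) => (p.1, p.2 0) := by fun_prop
    have hxt : Continuous fun p : Λ × (Fin (n + 1) → ℝ) =>
        ((p.1, p.2 0), (Fin.tail p.2 : Fin n → ℝ)) := by
      unfold Fin.tail; fun_prop
    have hbox : ∀ {x : Fin (n + 1) → ℝ}, x ∈ Icc (fun _ => -R) (fun _ => R) →
        x 0 ∈ Icc (-R) R ∧ (Fin.tail x : Fin n → ℝ) ∈ Icc (fun _ => -R) (fun _ => R) :=
      fun hx => ⟨⟨hx.1 0, hx.2 0⟩, fun i => hx.1 i.succ, fun i => hx.2 i.succ⟩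
    refine ⟨fun l x => Fin.cons (T1 l (x 0)) (T' (l, x 0) (Fin.tail x)),
      fun l x => Fin.cons (D1 l (x 0)) (D' (l, x 0) (Fin.tail x)),
      hcons (hT1c.comp hx0) (hTc.comp hxt), hcons (hD1c.comp hx0) (hDc.comp hxt),
        ?_, ?_, ?_, ?_, ?_⟩
    · intro l x i
      refine Fin.cases ?_ (fun j => ?_) i
      · simpa using hTD1 l (x 0)
      · simpa [Fin.tail_update_succ, Function.update_of_ne (Fin.succ_ne_zero j).symm,
          Fin.tail] using
          hTD (l, x 0) (Fin.tail x) j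
    · intro l x i
      refine Fin.cases ?_ (fun j => ?_) i
      · simpa using hD10 _ _
      · simpa using hD0 _ _ _
    · intro l x hx
      obtain ⟨h0, ht⟩ := hbox hx
      have h1 := hT1b l _ h0
      have h2 := hTb (l, x 0) _ ht
      exact ⟨Fin.cases h1.1 h2.1, Fin.cases h1.2 h2.2⟩
    · intro l x hx
      obtain ⟨h0, ht⟩ := hbox hx
      have h1 := hDG1 l _ h0
      have h2 := hDG (l, x 0) _ ht
      simp only [Fin.cons_self_tail] at h2
      rw [Fin.prod_univ_succ]
      simp only [Fin.cons_zero, Fin.cons_succ]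
      have e1 := (hF10 l (x 0)).ne'
      have e2 := (hG10 l (T1 l (x 0))).ne'
      field_simp at h2
      rw [← h1] at h2
      apply mul_right_cancel₀ e2
      rw [← mul_right_inj' e2]
      linear_combination (G1 l (T1 l (x 0))) * h2
    · intro l φ hφc
      have hTl : Continuous fun x : Fin (n + 1) → ℝ =>
          (Fin.cons (T1 l (x 0)) (T' (l, x 0) (Fin.tail x)) : Fin (n + 1) → ℝ) :=
        (hcons (hT1c.comp hx0) (hTc.comp hxt)).comp (Continuous.prodMk_right l)
      refine (fub _ ((hFl l).mul (hφc.comp hTl))).trans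
        (Eq.trans ?_ (fub _ ((hGl l).mul hφc)).symm)
      simp only [Pi.mul_apply, Function.comp_apply]
      have hcφ : Continuous fun p : ℝ × (Fin n → ℝ) => φ (Fin.cons p.1 p.2 : Fin (n + 1) → ℝ) :=
        hφc.comp (hcons continuous_fst continuous_snd)
      set k : ℝ → ℝ := fun s => (∫ y in Icc (fun _ => -R) (fun _ => R),
        G l (Fin.cons s y : Fin (n + 1) → ℝ) * φ (Fin.cons s y : Fin (n + 1) → ℝ)) / G1 l s with hk
      have hG1l : Continuous (G1 l) := hG1c.comp (Continuous.prodMk_right l)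
      have hkc : Continuous k := by
        refine Continuous.div ?_ hG1l fun s => (hG10 l s).ne'
        refine continuous_parametric_integral_of_continuous (μ := volume)
          (f := fun s y => G l (Fin.cons s y : Fin (n + 1) → ℝ) *
            φ (Fin.cons s y : Fin (n + 1) → ℝ)) ?_ hB
        exact ((hGl l).comp (hcons continuous_fst continuous_snd)).mul hcφ
      have key := integral_comp_of_monotone_transport hR (F := F1 l) hG1l hkc
        (hD1c.comp (Continuous.prodMk_right l)) (hTD1 l) (hT1m l) (hT1p l) (hDG1 l)
      have e1 : ∀ t, ∫ y in Icc (fun _ => -R) (fun _ => R), F l (Fin.cons t y : Fin (n + 1) → ℝ) *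
          φ (Fin.cons (T1 l t) (T' (l, t) y) : Fin (n + 1) → ℝ) = F1 l t * k (T1 l t) := by
        intro t
        have := hφ (l, t) (fun y => φ (Fin.cons (T1 l t) y : Fin (n + 1) → ℝ))
          (hcφ.comp (Continuous.prodMk_right _))
        simp only [div_mul_eq_mul_div, integral_div] at this
        rw [div_eq_iff (hF10 l t).ne'] at this
        rw [this, hk]; ring
      have e2 : ∀ t, ∫ y in Icc (fun _ => -R) (fun _ => R), G l (Fin.cons t y : Fin (n + 1) → ℝ) *
          φ (Fin.cons t y : Fin (n + 1) → ℝ) = G1 l t * k t := by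
        intro t
        rw [hk]; simp only
        rw [mul_div_cancel₀ _ (hG10 l t).ne']
      simp only [Fin.cons_zero, Fin.tail_cons, e1, e2]
      exact key

theorem setIntegral_box_mul_partial_le {n : ℕ} {R η : ℝ} (hR : 0 < R) (hη : 0 ≤ η) (i : Fin n)
    {H H' S S' : (Fin n → ℝ) → ℝ} (hHc : Continuous H) (hHc' : Continuous H')
    (hSc : Continuous S) (hSc' : Continuous S')
    (hH : ∀ x, HasDerivAt (fun s => H (Function.update x i s)) (H' x) (x i))
    (hS : ∀ x, HasDerivAt (fun s => S (Function.update x i s)) (S' x) (x i))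
    (hHη : ∀ x, (x i = R ∨ x i = -R) → H x = η)
    (hSb : ∀ x ∈ Icc (fun _ => -R) (fun _ => R), |S x| ≤ R) :
    ∫ x in Icc (fun _ => -R) (fun _ => R), H x * S' x ≤
      η * (2 * R) ^ n - ∫ x in Icc (fun _ => -R) (fun _ => R), H' x * S x := by
  obtain _ | n := n
  · exact i.elim0
  have hInt : ∀ {f : (Fin (n + 1) → ℝ) → ℝ}, Continuous f →
      IntegrableOn f (Icc (fun _ => -R) (fun _ => R)) := fun hf => hf.continuousOn.integrableOn_Icc
  have hi1 : IntegrableOn (fun x => H x * S' x) (Icc (fun _ => -R) (fun _ => R)) :=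
    hInt (hHc.mul hSc')
  have hi2 : IntegrableOn (fun x => H' x * S x) (Icc (fun _ => -R) (fun _ => R)) :=
    hInt (hHc'.mul hSc)
  have hsum : Continuous fun x => H x * S' x + H' x * S x := (hHc.mul hSc').add (hHc'.mul hSc)
  rw [le_sub_iff_add_le, ← integral_add hi1 hi2,
    setIntegral_box_insertNth_swap hR i hsum]
  have hins : ∀ y : Fin n → ℝ, Continuous fun t : ℝ => (i.insertNth t y : Fin (n + 1) → ℝ) :=
    fun y => Continuous.finInsertNth i continuous_id continuous_const
  have hmem : ∀ y ∈ Icc (fun _ : Fin n => -R) (fun _ => R), ∀ t ∈ Icc (-R) R,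
      (i.insertNth t y : Fin (n + 1) → ℝ) ∈ Icc (fun _ => -R) (fun _ => R) := by
    intro y hy t ht
    constructor
    · refine (Fin.le_insertNth_iff).2 ⟨ht.1, hy.1⟩
    · refine (Fin.insertNth_le_iff).2 ⟨ht.2, hy.2⟩
  have hftc : ∀ y : Fin n → ℝ,
      ∫ t in (-R)..R, (H (i.insertNth t y) * S' (i.insertNth t y) +
        H' (i.insertNth t y) * S (i.insertNth t y)) =
      η * (S (i.insertNth R y) - S (i.insertNth (-R) y)) := by
    intro y
    rw [intervalIntegral.integral_eq_sub_of_hasDerivAt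
      (f := fun t => H (i.insertNth t y) * S (i.insertNth t y))]
    · rw [hHη (i.insertNth R y) (by simp), hHη (i.insertNth (-R) y) (by simp)]; ring
    · intro t _
      have h1 := hH (i.insertNth t y)
      have h2 := hS (i.insertNth t y)
      simp only [Fin.update_insertNth, Fin.insertNth_apply_same] at h1 h2
      refine (h1.mul h2).congr_deriv (by ring)
    · exact (((hHc.comp (hins y)).mul (hSc'.comp (hins y))).add
        ((hHc'.comp (hins y)).mul (hSc.comp (hins y)))).intervalIntegrable _ _
  simp_rw [hftc]
  have hvol : volume.real (Icc (fun _ : Fin n => -R) (fun _ => R)) = (2 * R) ^ n := by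
    rw [Measure.real, Real.volume_Icc_pi_toReal (fun _ => by linarith)]
    simp; ring
  calc ∫ y in Icc (fun _ : Fin n => -R) (fun _ => R),
        η * (S (i.insertNth R y) - S (i.insertNth (-R) y))
      ≤ ∫ y in Icc (fun _ : Fin n => -R) (fun _ => R), η * (2 * R) := by
        refine setIntegral_mono_on ?_ ?_ measurableSet_Icc ?_
        · refine Continuous.integrableOn_Icc (continuous_const.mul (Continuous.sub ?_ ?_)) <;>
          exact hSc.comp (Continuous.finInsertNth i continuous_const continuous_id)
        · exact continuous_const.integrableOn_Icc
        · intro y hy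
          have h1 := abs_le.1 (hSb _ (hmem y hy R ⟨by linarith, le_rfl⟩))
          have h2 := abs_le.1 (hSb _ (hmem y hy (-R) ⟨le_rfl, by linarith⟩))
          gcongr; linarith [h1.2, h2.1]
    _ = η * (2 * R) ^ (n + 1) := by
        rw [setIntegral_const, hvol, smul_eq_mul]; ring

theorem setIntegral_box_rpow_le {n : ℕ} (hn : 0 < n) {R η : ℝ} (hR : 0 < R) (hη : 0 ≤ η)
    {F G : (Fin n → ℝ) → ℝ} (hF : Continuous F) (hG : Continuous G)
    (hF0 : ∀ x, 0 < F x) (hG0 : ∀ x, 0 < G x)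
    (hFG : ∫ x in Icc (fun _ => -R) (fun _ => R), F x = ∫ x in Icc (fun _ => -R) (fun _ => R), G x)
    {H' : Fin n → (Fin n → ℝ) → ℝ} (hH' : ∀ i, Continuous (H' i))
    (hH : ∀ i x, HasDerivAt (fun s => F (Function.update x i s) ^ (1 - 1 / (n : ℝ))) (H' i x) (x i))
    (hFη : ∀ i x, (x i = R ∨ x i = -R) → F x ^ (1 - 1 / (n : ℝ)) = η) {k : ℝ} (hk : 0 < k) :
    n * ∫ x in Icc (fun _ => -R) (fun _ => R), G x ^ (1 - 1 / (n : ℝ)) ≤ n * (η * (2 * R) ^ n) +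
      1 / (2 * k) * (∫ x in Icc (fun _ => -R) (fun _ => R), (∑ i, H' i x ^ 2) / F x) +
      k / 2 * ∫ x in Icc (fun _ => -R) (fun _ => R), G x * ∑ i, x i ^ 2 := by
  obtain ⟨T, D, hTc, hDc, hTD, hD0, hTb, hDG, hφ⟩ := exists_knothe_map n hR (Λ := Unit)
    (F := fun _ => F) (G := fun _ => G) (hF.comp continuous_snd) (hG.comp continuous_snd)
    (fun _ => hF0) (fun _ => hG0) (fun _ => hFG)
  replace hTc : Continuous (T ()) := hTc.comp (Continuous.prodMk_right ())
  replace hDc : Continuous (D ()) := hDc.comp (Continuous.prodMk_right ())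
  replace hTD := hTD (); replace hD0 := hD0 (); replace hTb := hTb (); replace hDG := hDG ()
  replace hφ := hφ ()
  set t := T ()
  set d := D ()
  have hn' : (0 : ℝ) < n := by exact_mod_cast hn
  have hInt : ∀ {f : (Fin n → ℝ) → ℝ}, Continuous f →
      IntegrableOn f (Icc (fun _ => -R) (fun _ => R)) := fun hf => hf.continuousOn.integrableOn_Icc
  have hHc : Continuous fun x => F x ^ (1 - 1 / (n : ℝ)) :=
    hF.rpow_const fun x => Or.inl (hF0 x).ne'
  have htc : ∀ i, Continuous fun x => t x i := fun i => (continuous_apply i).comp hTc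
  have hdc : ∀ i, Continuous fun x => d x i := fun i => (continuous_apply i).comp hDc
  have e1 : ∫ x in Icc (fun _ => -R) (fun _ => R), G x ^ (1 - 1 / (n : ℝ)) =
      ∫ x in Icc (fun _ => -R) (fun _ => R), F x * G (t x) ^ (-(1 / (n : ℝ))) := by
    rw [hφ (fun y => G y ^ (-(1 / (n : ℝ)))) (hG.rpow_const fun x => Or.inl (hG0 x).ne')]
    refine integral_congr_ae (Eventually.of_forall fun x => ?_)
    simp only
    rw [sub_eq_add_neg, rpow_add (hG0 x), rpow_one]
  have e2 : ∫ x in Icc (fun _ => -R) (fun _ => R), G x * ∑ i, x i ^ 2 =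
      ∫ x in Icc (fun _ => -R) (fun _ => R), F x * ∑ i, t x i ^ 2 :=
    (hφ (fun y => ∑ i, y i ^ 2) (by fun_prop)).symm
  have amgm : ∀ x ∈ Icc (fun _ => -R) (fun _ => R),
      n * (F x * G (t x) ^ (-(1 / (n : ℝ)))) ≤ ∑ i, F x ^ (1 - 1 / (n : ℝ)) * d x i := by
    intro x hx
    have h := Real.geom_mean_le_arith_mean_weighted Finset.univ (fun _ => 1 / (n : ℝ)) (d x)
      (fun _ _ => by positivity) (by simp [hn'.ne']) (fun i _ => (hD0 x i).le)
    rw [Real.finsetProd_rpow _ _ fun i _ => (hD0 x i).le, ← Finset.mul_sum] at h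
    have h2 : ∏ i, d x i = F x * (G (t x))⁻¹ := by
      rw [← hDG x hx, mul_inv_cancel_right₀ (hG0 _).ne']
    rw [h2, mul_rpow (hF0 x).le (inv_nonneg.2 (hG0 _).le), inv_rpow (hG0 _).le,
      ← rpow_neg (hG0 _).le, one_div_mul_eq_div, le_div_iff₀ hn'] at h
    rw [← Finset.mul_sum]
    calc n * (F x * G (t x) ^ (-(1 / (n : ℝ))))
        = F x ^ (1 - 1 / (n : ℝ)) * (F x ^ (1 / (n : ℝ)) * G (t x) ^ (-(1 / (n : ℝ))) * n) := by
          have : F x = F x ^ (1 - 1 / (n : ℝ)) * F x ^ (1 / (n : ℝ)) := by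
            rw [← rpow_add (hF0 x)]; simp
          conv_lhs => rw [this]
          ring
      _ ≤ _ := mul_le_mul_of_nonneg_left h (rpow_nonneg (hF0 x).le _)
  have ibp : ∀ i, ∫ x in Icc (fun _ => -R) (fun _ => R), F x ^ (1 - 1 / (n : ℝ)) * d x i ≤
      η * (2 * R) ^ n - ∫ x in Icc (fun _ => -R) (fun _ => R), H' i x * t x i := fun i =>
    setIntegral_box_mul_partial_le hR hη i hHc (hH' i) (htc i) (hdc i) (hH i)
      (fun x => hTD x i) (hFη i) (fun x hx => abs_le.2 ⟨(hTb x hx).1 i, (hTb x hx).2 i⟩)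
  have young : ∀ x, -∑ i, H' i x * t x i ≤
      1 / (2 * k) * ((∑ i, H' i x ^ 2) / F x) + k / 2 * (F x * ∑ i, t x i ^ 2) := by
    intro x
    rw [Finset.sum_div, Finset.mul_sum, Finset.mul_sum, Finset.mul_sum, ← Finset.sum_add_distrib,
      ← Finset.sum_neg_distrib]
    refine Finset.sum_le_sum fun i _ => ?_
    have hFx := hF0 x
    have : 1 / (2 * k) * (H' i x ^ 2 / F x) + k / 2 * (F x * t x i ^ 2) - -(H' i x * t x i) =
        (H' i x + k * F x * t x i) ^ 2 / (2 * k * F x) := by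
      field_simp; ring
    have h2 : 0 ≤ (H' i x + k * F x * t x i) ^ 2 / (2 * k * F x) := by positivity
    linarith
  have hGtc : Continuous fun x => F x * G (t x) ^ (-(1 / (n : ℝ))) :=
    hF.mul ((hG.comp hTc).rpow_const fun x => Or.inl (hG0 _).ne')
  have hq1 : Continuous fun x => (∑ i, H' i x ^ 2) / F x :=
    (continuous_finsetSum _ fun i _ => (hH' i).pow 2).div hF fun x => (hF0 x).ne'
  have hq2 : Continuous fun x => F x * ∑ i, t x i ^ 2 :=
    hF.mul (continuous_finsetSum _ fun i _ => (htc i).pow 2)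
  have hHt : ∀ i, IntegrableOn (fun x => H' i x * t x i) (Icc (fun _ => -R) (fun _ => R)) :=
    fun i => hInt ((hH' i).mul (htc i))
  have hiq1 : IntegrableOn (fun x => 1 / (2 * k) * ((∑ i, H' i x ^ 2) / F x))
      (Icc (fun _ => -R) (fun _ => R)) := hInt (continuous_const.mul hq1)
  have hiq2 : IntegrableOn (fun x => k / 2 * (F x * ∑ i, t x i ^ 2))
      (Icc (fun _ => -R) (fun _ => R)) := hInt (continuous_const.mul hq2)
  calc n * ∫ x in Icc (fun _ => -R) (fun _ => R), G x ^ (1 - 1 / (n : ℝ))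
      = ∫ x in Icc (fun _ => -R) (fun _ => R), n * (F x * G (t x) ^ (-(1 / (n : ℝ)))) := by
        rw [e1, integral_const_mul]
    _ ≤ ∫ x in Icc (fun _ => -R) (fun _ => R), ∑ i, F x ^ (1 - 1 / (n : ℝ)) * d x i :=
        setIntegral_mono_on (hInt (continuous_const.mul hGtc))
          (hInt (continuous_finsetSum _ fun i _ => hHc.mul (hdc i))) measurableSet_Icc amgm
    _ = ∑ i, ∫ x in Icc (fun _ => -R) (fun _ => R), F x ^ (1 - 1 / (n : ℝ)) * d x i :=
        integral_finsetSum _ fun i _ => hInt (hHc.mul (hdc i))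
    _ ≤ ∑ i, (η * (2 * R) ^ n - ∫ x in Icc (fun _ => -R) (fun _ => R), H' i x * t x i) :=
        Finset.sum_le_sum fun i _ => ibp i
    _ = n * (η * (2 * R) ^ n) + ∫ x in Icc (fun _ => -R) (fun _ => R), -∑ i, H' i x * t x i := by
        rw [Finset.sum_sub_distrib, integral_neg,
          integral_finsetSum _ fun i _ => hHt i]
        simp [sub_eq_add_neg]
    _ ≤ n * (η * (2 * R) ^ n) + ∫ x in Icc (fun _ => -R) (fun _ => R),
          (1 / (2 * k) * ((∑ i, H' i x ^ 2) / F x) + k / 2 * (F x * ∑ i, t x i ^ 2)) := by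
        refine add_le_add le_rfl
          (setIntegral_mono_on (hInt ?_) (hiq1.add hiq2) measurableSet_Icc fun x _ => young x)
        exact (continuous_finsetSum _ fun i _ => (hH' i).mul (htc i)).neg
    _ = _ := by
        rw [integral_add hiq1 hiq2,
          integral_const_mul, integral_const_mul, e2]
        ring

theorem lintegral_one_add_norm_sq_rpow_neg {n : ℕ} {s : ℝ} (hs : (n : ℝ) / 2 < s) :
    ∫⁻ x : EuclideanSpace ℝ (Fin n), ENNReal.ofReal ((1 + ‖x‖ ^ 2) ^ (-s)) =
      ENNReal.ofReal (π ^ ((n : ℝ) / 2) * (Gamma (s - n / 2) / Gamma s)) := by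
  have hs0 : 0 < s := lt_of_le_of_lt (by positivity) hs
  have hΓ := Gamma_pos_of_pos hs0
  have h1 : ∀ x : EuclideanSpace ℝ (Fin n), ENNReal.ofReal ((1 + ‖x‖ ^ 2) ^ (-s)) =
      ENNReal.ofReal (Gamma s)⁻¹ * ∫⁻ t in Ioi (0 : ℝ),
        ENNReal.ofReal (t ^ (s - 1) * exp (-((1 + ‖x‖ ^ 2) * t))) := by
    intro x
    have hx : 0 < 1 + ‖x‖ ^ 2 := by positivity
    rw [← ofReal_integral_eq_lintegral_ofReal, integral_rpow_mul_exp_neg_mul_Ioi hs0 hx,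
      ← ENNReal.ofReal_mul (by positivity)]
    · congr 1
      rw [one_div, inv_rpow hx.le, rpow_neg hx.le]; field_simp
    · by_contra hcon
      have := integral_rpow_mul_exp_neg_mul_Ioi hs0 hx
      rw [integral_undef hcon] at this
      have : 0 < (1 / (1 + ‖x‖ ^ 2)) ^ s * Gamma s := by positivity
      linarith
    · filter_upwards [ae_restrict_mem measurableSet_Ioi] with t ht
      have : (0 : ℝ) < t := ht
      positivity
  have h2 : ∀ t ∈ Ioi (0 : ℝ), ∫⁻ x : EuclideanSpace ℝ (Fin n),
      ENNReal.ofReal (t ^ (s - 1) * exp (-((1 + ‖x‖ ^ 2) * t))) =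
      ENNReal.ofReal (π ^ ((n : ℝ) / 2)) *
        ENNReal.ofReal (t ^ (s - n / 2 - 1) * exp (-(1 * t))) := by
    intro t ht
    have ht : (0 : ℝ) < t := ht
    have e : ∀ x : EuclideanSpace ℝ (Fin n), t ^ (s - 1) * exp (-((1 + ‖x‖ ^ 2) * t)) =
        t ^ (s - 1) * exp (-t) * exp (-t * ‖x‖ ^ 2) := by
      intro x
      rw [mul_assoc, ← exp_add]; ring_nf
    simp_rw [e]
    have hg := GaussianFourier.integral_rexp_neg_mul_sq_norm (V := EuclideanSpace ℝ (Fin n)) ht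
    rw [← ofReal_integral_eq_lintegral_ofReal, integral_const_mul, hg,
      ← ENNReal.ofReal_mul (by positivity)]
    · congr 1
      rw [finrank_euclideanSpace_fin, div_rpow pi_pos.le ht.le,
        show s - n / 2 - 1 = (s - 1) - n / 2 by ring, rpow_sub ht (s - 1)]
      generalize t ^ (s - 1) = p
      simp only [one_mul]; ring
    · refine Integrable.const_mul ?_ _
      by_contra hcon
      rw [integral_undef hcon] at hg
      have : 0 < (π / t) ^ ((Module.finrank ℝ (EuclideanSpace ℝ (Fin n)) : ℝ) / 2) := by positivity
      linarith
    · filter_upwards with x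
      positivity
  have hs' : 0 < s - n / 2 := by linarith
  simp_rw [h1]
  rw [lintegral_const_mul _ (by fun_prop), lintegral_lintegral_swap (by fun_prop),
    setLIntegral_congr_fun measurableSet_Ioi h2, lintegral_const_mul _ (by fun_prop),
    ← ofReal_integral_eq_lintegral_ofReal, integral_rpow_mul_exp_neg_mul_Ioi hs' one_pos,
    ← ENNReal.ofReal_mul (by positivity), ← ENNReal.ofReal_mul (by positivity)]
  · congr 1
    simp; field_simp
  · by_contra hcon
    have := integral_rpow_mul_exp_neg_mul_Ioi hs' one_pos
    rw [integral_undef hcon] at this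
    have h3 := Gamma_pos_of_pos hs'
    have : 0 < (1 / (1 : ℝ)) ^ (s - n / 2) * Gamma (s - n / 2) := by positivity
    linarith
  · filter_upwards [ae_restrict_mem measurableSet_Ioi] with t ht
    have : (0 : ℝ) < t := ht
    positivity

theorem integrable_one_add_norm_sq_rpow_neg {n : ℕ} {s : ℝ} (hs : (n : ℝ) / 2 < s) :
    Integrable fun x : EuclideanSpace ℝ (Fin n) => (1 + ‖x‖ ^ 2) ^ (-s) := by
  refine ⟨(by fun_prop : Measurable _).aestronglyMeasurable, ?_⟩
  rw [hasFiniteIntegral_iff_ofReal (Eventually.of_forall fun x => by positivity),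
    lintegral_one_add_norm_sq_rpow_neg hs]
  exact ENNReal.ofReal_lt_top

theorem integral_one_add_norm_sq_rpow_neg {n : ℕ} {s : ℝ} (hs : (n : ℝ) / 2 < s) :
    ∫ x : EuclideanSpace ℝ (Fin n), (1 + ‖x‖ ^ 2) ^ (-s) =
      π ^ ((n : ℝ) / 2) * (Gamma (s - n / 2) / Gamma s) := by
  have h1 := Gamma_pos_of_pos (lt_of_le_of_lt (by positivity) hs)
  have h2 := Gamma_pos_of_pos (sub_pos.2 hs)
  rw [integral_eq_lintegral_of_nonneg_ae (Eventually.of_forall fun x => by positivity)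
    (by fun_prop : Measurable _).aestronglyMeasurable, lintegral_one_add_norm_sq_rpow_neg hs,
    ENNReal.toReal_ofReal (by positivity)]

theorem sobolev_box_regularized {n : ℕ} (hn : 3 ≤ n) {R : ℝ} (hR : 0 < R)
    {v : (Fin n → ℝ) → ℝ} {v' : Fin n → (Fin n → ℝ) → ℝ} (hv : Continuous v)
    (hv' : ∀ i, Continuous (v' i))
    (hd : ∀ i x, HasDerivAt (fun s => v (Function.update x i s)) (v' i x) (x i))
    (h0 : ∀ i x, (x i = R ∨ x i = -R) → v x = 0) {k ε A κ : ℝ} (hk : 0 < k) (hε : 0 < ε)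
    (hA : A = ∫ x in Icc (fun _ : Fin n => -R) (fun _ => R), (1 + ∑ i, x i ^ 2) ^ (-(n : ℝ)))
    (hκ : κ = ((∫ x in Icc (fun _ => -R) (fun _ => R), |v x| ^ (2 * (n : ℝ) / (n - 2))) +
      ε * (2 * R) ^ n) / A) :
    n * (κ ^ (1 - 1 / (n : ℝ)) * ∫ x in Icc (fun _ : Fin n => -R) (fun _ => R),
        (1 + ∑ i, x i ^ 2) ^ (-((n : ℝ) - 1))) ≤
      n * (ε ^ (1 - 1 / (n : ℝ)) * (2 * R) ^ n) +
      1 / (2 * k) * ((2 * ((n : ℝ) - 1) / (n - 2)) ^ 2 *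
        ∫ x in Icc (fun _ => -R) (fun _ => R), ∑ i, v' i x ^ 2) +
      k / 2 * (κ * ∫ x in Icc (fun _ : Fin n => -R) (fun _ => R),
        (1 + ∑ i, x i ^ 2) ^ (-(n : ℝ)) * ∑ i, x i ^ 2) := by
  have hn3 : (3 : ℝ) ≤ n := by exact_mod_cast hn
  have hn0 : (0 : ℝ) < n := by linarith
  have hn2 : (0 : ℝ) < n - 2 := by linarith
  set q : ℝ := 2 * (n : ℝ) / (n - 2) with hq
  have hq2 : 2 < q := by rw [hq, lt_div_iff₀ hn2]; linarith
  set F : (Fin n → ℝ) → ℝ := fun x => |v x| ^ q + ε with hFdef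
  have hvq : Continuous fun x => |v x| ^ q := hv.abs.rpow_const fun _ => Or.inr (by linarith)
  have hF : Continuous F := hvq.add continuous_const
  have hF0 : ∀ x, 0 < F x := fun x => by positivity
  have hh0 : ∀ x : Fin n → ℝ, 0 < 1 + ∑ i, x i ^ 2 := fun x => by positivity
  have hhc : ∀ s : ℝ, Continuous fun x : Fin n → ℝ => (1 + ∑ i, x i ^ 2) ^ s := fun s =>
    Continuous.rpow_const (by fun_prop) fun x => Or.inl (hh0 x).ne'
  have hInt : ∀ {f : (Fin n → ℝ) → ℝ}, Continuous f →
      IntegrableOn f (Icc (fun _ => -R) (fun _ => R)) := fun hf => hf.continuousOn.integrableOn_Icc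
  have hvol : volume.real (Icc (fun _ : Fin n => -R) (fun _ => R)) = (2 * R) ^ n := by
    rw [Measure.real, Real.volume_Icc_pi_toReal (fun _ => by linarith)]
    simp; ring
  have hApos : 0 < A := hA ▸ setIntegral_box_pos hR (hhc _) fun x => rpow_pos_of_pos (hh0 x) _
  have hFint : ∫ x in Icc (fun _ => -R) (fun _ => R), F x = κ * A := by
    rw [hκ, div_mul_cancel₀ _ hApos.ne', hFdef, integral_add (hInt hvq) (hInt continuous_const),
      setIntegral_const, hvol, smul_eq_mul]
    ring
  have hκ0 : 0 < κ := by
    have := setIntegral_box_pos hR hF hF0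
    rw [hFint] at this
    exact pos_of_mul_pos_left this hApos.le
  set H' : Fin n → (Fin n → ℝ) → ℝ := fun i x =>
    (q * |v x| ^ (q - 2) * v x * v' i x) * (1 - 1 / (n : ℝ)) * F x ^ (1 - 1 / (n : ℝ) - 1) with hH'
  have hv2 : Continuous fun x => |v x| ^ (q - 2) :=
    hv.abs.rpow_const fun _ => Or.inr (by linarith)
  have hH'c : ∀ i, Continuous (H' i) := fun i =>
    (((((continuous_const.mul hv2).mul hv).mul (hv' i))).mul continuous_const).mul
      (hF.rpow_const fun x => Or.inl (hF0 x).ne')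
  have key := setIntegral_box_rpow_le (n := n) (by omega) hR (rpow_nonneg hε.le (1 - 1 / (n : ℝ)))
    hF (G := fun x => κ * (1 + ∑ i, x i ^ 2) ^ (-(n : ℝ))) (continuous_const.mul (hhc _)) hF0
    (fun x => mul_pos hκ0 (rpow_pos_of_pos (hh0 x) _))
    (by rw [hFint, integral_const_mul, hA]) hH'c
    (fun i x => by
      have h1 := (hasDerivAt_abs_rpow (v (Function.update x i (x i))) (p := q) (by linarith)).comp
        (x i) (hd i x)
      have h2 := (h1.add_const ε).rpow_const (p := 1 - 1 / (n : ℝ))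
        (Or.inl (by
            have := hF0 x
            simp only [Function.comp, Function.update_eq_self]
            exact this.ne'))
      simpa only [Function.comp, Function.update_eq_self] using h2)
    (fun i x hx => by
      simp only [hFdef]
      rw [h0 i x hx, abs_zero, zero_rpow (by linarith), zero_add]) hk
  have e1 : ∀ x : Fin n → ℝ, (κ * (1 + ∑ i, x i ^ 2) ^ (-(n : ℝ))) ^ (1 - 1 / (n : ℝ)) =
      κ ^ (1 - 1 / (n : ℝ)) * (1 + ∑ i, x i ^ 2) ^ (-((n : ℝ) - 1)) := by
    intro x
    rw [mul_rpow hκ0.le (rpow_nonneg (hh0 x).le _), ← rpow_mul (hh0 x).le]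
    congr 2
    field_simp
  simp_rw [e1] at key
  simp_rw [mul_assoc κ] at key
  rw [integral_const_mul, integral_const_mul] at key
  refine key.trans ?_
  rw [← integral_const_mul ((2 * ((n : ℝ) - 1) / (n - 2)) ^ 2)]
  refine add_le_add (add_le_add le_rfl (mul_le_mul_of_nonneg_left ?_ (by positivity))) le_rfl
  refine setIntegral_mono_on (hInt ?_) (hInt ?_) measurableSet_Icc fun x _ => ?_
  · exact (continuous_finsetSum _ fun i _ => (hH'c i).pow 2).div hF fun x => (hF0 x).ne'
  · exact continuous_const.mul (continuous_finsetSum _ fun i _ => (hv' i).pow 2)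
  · have hFx := hF0 x
    rw [div_le_iff₀ hFx]
    have e2 : ∑ i, H' i x ^ 2 = (2 * ((n : ℝ) - 1) / (n - 2)) ^ 2 * (∑ i, v' i x ^ 2) *
        ((|v x| ^ (q - 2) * v x * F x ^ (-(1 / (n : ℝ)))) ^ 2) := by
      rw [Finset.mul_sum, Finset.sum_mul]
      refine Finset.sum_congr rfl fun i _ => ?_
      have : 1 - 1 / (n : ℝ) - 1 = -(1 / (n : ℝ)) := by ring
      simp only [hH', this]
      have : 2 * ((n : ℝ) - 1) / (n - 2) = q * (1 - 1 / n) := by rw [hq]; field_simp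
      rw [this]; ring
    rw [e2]
    refine mul_le_mul_of_nonneg_left ?_ (by positivity)
    have e3 : (|v x| ^ (q - 2) * v x) ^ 2 = (|v x| ^ q) ^ (1 + 2 / (n : ℝ)) := by
      rcases eq_or_ne (v x) 0 with hz | hz
      · rw [hz, abs_zero, zero_rpow (by linarith : q ≠ 0),
          zero_rpow (show 1 + 2 / (n : ℝ) ≠ 0 by positivity)]
        simp
      · have ha : 0 < |v x| := abs_pos.2 hz
        rw [mul_pow, ← sq_abs (v x), ← rpow_natCast, ← rpow_natCast |v x|, ← rpow_mul ha.le,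
          ← rpow_add ha, ← rpow_mul ha.le]
        congr 1
        rw [hq]; push_cast; field_simp; ring
    rw [mul_pow, e3, ← rpow_natCast (F x ^ _), ← rpow_mul hFx.le]
    calc (|v x| ^ q) ^ (1 + 2 / (n : ℝ)) * F x ^ (-(1 / (n : ℝ)) * ((2 : ℕ) : ℝ))
        ≤ F x ^ (1 + 2 / (n : ℝ)) * F x ^ (-(1 / (n : ℝ)) * ((2 : ℕ) : ℝ)) := by
          gcongr
          simp only [hFdef]; linarith
      _ = F x := by
          rw [← rpow_add hFx]
          conv_rhs => rw [← rpow_one (F x)]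
          congr 1; push_cast; ring

theorem sobolev_box {n : ℕ} (hn : 3 ≤ n) {R : ℝ} (hR : 0 < R)
    {v : (Fin n → ℝ) → ℝ} {v' : Fin n → (Fin n → ℝ) → ℝ} (hv : Continuous v)
    (hv' : ∀ i, Continuous (v' i))
    (hd : ∀ i x, HasDerivAt (fun s => v (Function.update x i s)) (v' i x) (x i))
    (h0 : ∀ i x, (x i = R ∨ x i = -R) → v x = 0) {k A κ : ℝ} (hk : 0 < k)
    (hA : A = ∫ x in Icc (fun _ : Fin n => -R) (fun _ => R), (1 + ∑ i, x i ^ 2) ^ (-(n : ℝ)))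
    (hκ : κ = (∫ x in Icc (fun _ => -R) (fun _ => R), |v x| ^ (2 * (n : ℝ) / (n - 2))) / A) :
    n * (κ ^ (1 - 1 / (n : ℝ)) * ∫ x in Icc (fun _ : Fin n => -R) (fun _ => R),
        (1 + ∑ i, x i ^ 2) ^ (-((n : ℝ) - 1))) ≤
      1 / (2 * k) * ((2 * ((n : ℝ) - 1) / (n - 2)) ^ 2 *
        ∫ x in Icc (fun _ => -R) (fun _ => R), ∑ i, v' i x ^ 2) +
      k / 2 * (κ * ∫ x in Icc (fun _ : Fin n => -R) (fun _ => R),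
        (1 + ∑ i, x i ^ 2) ^ (-(n : ℝ)) * ∑ i, x i ^ 2) := by
  have hn3 : (3 : ℝ) ≤ n := by exact_mod_cast hn
  have hp : 0 < 1 - 1 / (n : ℝ) := by
    rw [sub_pos, div_lt_one (by linarith)]; linarith
  set m := ∫ x in Icc (fun _ => -R) (fun _ => R), |v x| ^ (2 * (n : ℝ) / (n - 2)) with hm
  set B := ∫ x in Icc (fun _ : Fin n => -R) (fun _ => R), (1 + ∑ i, x i ^ 2) ^ (-((n : ℝ) - 1))
  set C := ∫ x in Icc (fun _ : Fin n => -R) (fun _ => R),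
        (1 + ∑ i, x i ^ 2) ^ (-(n : ℝ)) * ∑ i, x i ^ 2
  set E := ∫ x in Icc (fun _ => -R) (fun _ => R), ∑ i, v' i x ^ 2
  have hκc : Continuous fun ε : ℝ => (m + ε * (2 * R) ^ n) / A := by fun_prop
  have hl : Continuous fun ε : ℝ => n * (((m + ε * (2 * R) ^ n) / A) ^ (1 - 1 / (n : ℝ)) * B) :=
    continuous_const.mul ((hκc.rpow_const fun _ => Or.inr hp.le).mul continuous_const)
  have hr : Continuous fun ε : ℝ => n * (ε ^ (1 - 1 / (n : ℝ)) * (2 * R) ^ n) +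
      1 / (2 * k) * ((2 * ((n : ℝ) - 1) / (n - 2)) ^ 2 * E) +
      k / 2 * (((m + ε * (2 * R) ^ n) / A) * C) := by
    have : Continuous fun ε : ℝ => ε ^ (1 - 1 / (n : ℝ)) :=
      continuous_id.rpow_const fun _ => Or.inr hp.le
    fun_prop
  have := le_of_tendsto_of_tendsto (b := 𝓝[>] (0 : ℝ))
    (hl.tendsto 0 |>.mono_left nhdsWithin_le_nhds)
    (hr.tendsto 0 |>.mono_left nhdsWithin_le_nhds) (by
      filter_upwards [self_mem_nhdsWithin] with ε hε
      exact sobolev_box_regularized hn hR hv hv' hd h0 hk hε hA rfl)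
  simp only [zero_mul, add_zero, zero_rpow hp.ne', mul_zero, zero_add, ← hκ] at this
  exact this

theorem tendsto_setIntegral_box {n : ℕ} {f : (Fin n → ℝ) → ℝ} (hf : Integrable f) :
    Tendsto (fun N : ℕ => ∫ x in Icc (fun _ => -(N : ℝ)) (fun _ => (N : ℝ)), f x) atTop
      (𝓝 (∫ x, f x)) := by
  have hU : ⋃ N : ℕ, Icc (fun _ : Fin n => -(N : ℝ)) (fun _ => (N : ℝ)) = univ := by
    refine eq_univ_of_forall fun x => mem_iUnion.2 ?_
    obtain ⟨N, hN⟩ := exists_nat_ge ‖x‖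
    refine ⟨N, fun i => ?_, fun i => ?_⟩
    · exact (abs_le.1 ((norm_le_pi_norm x i).trans hN)).1
    · exact (abs_le.1 ((norm_le_pi_norm x i).trans hN)).2
  have h := tendsto_setIntegral_of_monotone (μ := volume) (f := f)
    (s := fun N : ℕ => Icc (fun _ : Fin n => -(N : ℝ)) (fun _ => (N : ℝ)))
    (fun _ => measurableSet_Icc)
    (fun M N hMN => by
      have : (M : ℝ) ≤ N := by exact_mod_cast hMN
      exact Icc_subset_Icc (fun _ => neg_le_neg this) (fun _ => this))
        (by rw [hU]; exact hf.integrableOn)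
  simpa only [hU, setIntegral_univ] using h

theorem sobolev_pi {n : ℕ} (hn : 3 ≤ n)
    {v : (Fin n → ℝ) → ℝ} {v' : Fin n → (Fin n → ℝ) → ℝ} (hv : Continuous v)
    (hv' : ∀ i, Continuous (v' i)) (hvs : HasCompactSupport v)
    (hvs' : ∀ i, HasCompactSupport (v' i))
    (hd : ∀ i x, HasDerivAt (fun s => v (Function.update x i s)) (v' i x) (x i))
    (hA : Integrable fun x : Fin n → ℝ => (1 + ∑ i, x i ^ 2) ^ (-(n : ℝ)))
    (hB : Integrable fun x : Fin n → ℝ => (1 + ∑ i, x i ^ 2) ^ (-((n : ℝ) - 1)))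
    (hA0 : 0 < ∫ x : Fin n → ℝ, (1 + ∑ i, x i ^ 2) ^ (-(n : ℝ))) {k A m : ℝ} (hk : 0 < k)
    (hAe : A = ∫ x : Fin n → ℝ, (1 + ∑ i, x i ^ 2) ^ (-(n : ℝ)))
    (hm : m = ∫ x, |v x| ^ (2 * (n : ℝ) / (n - 2))) :
    n * ((m / A) ^ (1 - 1 / (n : ℝ)) * ∫ x : Fin n → ℝ, (1 + ∑ i, x i ^ 2) ^ (-((n : ℝ) - 1))) ≤
      1 / (2 * k) * ((2 * ((n : ℝ) - 1) / (n - 2)) ^ 2 * ∫ x, ∑ i, v' i x ^ 2) +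
      k / 2 * (m / A * ((∫ x : Fin n → ℝ, (1 + ∑ i, x i ^ 2) ^ (-((n : ℝ) - 1))) - A)) := by
  have hn3 : (3 : ℝ) ≤ n := by exact_mod_cast hn
  have hn2 : (0 : ℝ) < n - 2 := by linarith
  have hp : 0 < 1 - 1 / (n : ℝ) := by
    rw [sub_pos, div_lt_one (by linarith)]; linarith
  have hq : 0 < 2 * (n : ℝ) / (n - 2) := by positivity
  have hmint : Integrable fun x => |v x| ^ (2 * (n : ℝ) / (n - 2)) :=
    (hv.abs.rpow_const fun _ => Or.inr hq.le).integrable_of_hasCompactSupport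
      (hvs.comp_left (g := fun t : ℝ => |t| ^ (2 * (n : ℝ) / (n - 2)))
        (by simp [zero_rpow hq.ne']))
  have hEi : ∀ i, Integrable fun x => v' i x ^ 2 := fun i => by
    have h1 : Continuous fun x => v' i x ^ 2 := (hv' i).pow 2
    have h2 : HasCompactSupport fun x => v' i x ^ 2 := by
      simpa only [pow_two, Pi.mul_def] using (hvs' i).mul_right (f' := v' i)
    exact h1.integrable_of_hasCompactSupport h2
  have hE : Integrable fun x => ∑ i, v' i x ^ 2 := integrable_finsetSum _ fun i _ => hEi i
  have hCe : ∀ x : Fin n → ℝ, (1 + ∑ i, x i ^ 2) ^ (-(n : ℝ)) * ∑ i, x i ^ 2 =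
      (1 + ∑ i, x i ^ 2) ^ (-((n : ℝ) - 1)) - (1 + ∑ i, x i ^ 2) ^ (-(n : ℝ)) := by
    intro x
    have h0 : 0 < 1 + ∑ i, x i ^ 2 := by positivity
    have : -((n : ℝ) - 1) = -(n : ℝ) + 1 := by ring
    rw [this, rpow_add h0, rpow_one]; ring
  have hC : Integrable fun x : Fin n → ℝ => (1 + ∑ i, x i ^ 2) ^ (-(n : ℝ)) * ∑ i, x i ^ 2 := by
    simp_rw [hCe]; exact hB.sub hA
  have tA := tendsto_setIntegral_box hA
  have tB := tendsto_setIntegral_box hB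
  have tC := tendsto_setIntegral_box hC
  have tm := tendsto_setIntegral_box hmint
  have tE := tendsto_setIntegral_box hE
  have tκ := tm.div tA hA0.ne'
  have hCint : ∫ x : Fin n → ℝ, (1 + ∑ i, x i ^ 2) ^ (-(n : ℝ)) * ∑ i, x i ^ 2 =
      (∫ x : Fin n → ℝ, (1 + ∑ i, x i ^ 2) ^ (-((n : ℝ) - 1))) - A := by
    simp_rw [hCe]; rw [integral_sub hB hA, hAe]
  obtain ⟨ρ, hρ⟩ := hvs.isCompact.isBounded.subset_closedBall 0
  have hz : ∀ᶠ N : ℕ in atTop, ∀ (i : Fin n) x, (x i = (N : ℝ) ∨ x i = -(N : ℝ)) → v x = 0 := by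
    obtain ⟨M, hM⟩ := exists_nat_gt ρ
    filter_upwards [eventually_ge_atTop M] with N hN i x hx
    by_contra h
    have h1 := hρ (subset_tsupport _ h)
    rw [mem_closedBall_zero_iff] at h1
    have h2 := (norm_le_pi_norm x i).trans h1
    have h3 : (M : ℝ) ≤ N := by exact_mod_cast hN
    have h4 : ‖x i‖ = N := by rcases hx with h | h <;> simp [h]
    linarith
  rw [← hCint, hm, hAe]
  have hl := (tκ.rpow_const (p := 1 - 1 / (n : ℝ)) (Or.inr hp.le)).mul tB |>.const_mul (n : ℝ)
  have hr := ((tE.const_mul ((2 * ((n : ℝ) - 1) / (n - 2)) ^ 2)).const_mul (1 / (2 * k))).add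
    ((tκ.mul tC).const_mul (k / 2))
  refine le_of_tendsto_of_tendsto hl hr ?_
  filter_upwards [hz, eventually_gt_atTop 0] with N hN hN0
  have := sobolev_box hn (by exact_mod_cast hN0) hv hv' hd hN hk rfl rfl
  exact this

theorem integral_one_add_norm_sq_rpow_neg_sub_one {n : ℕ} (hn : 3 ≤ n) :
    ∫ x : EuclideanSpace ℝ (Fin n), (1 + ‖x‖ ^ 2) ^ (-((n : ℝ) - 1)) =
      2 * ((n : ℝ) - 1) / (n - 2) *
        ∫ x : EuclideanSpace ℝ (Fin n), (1 + ‖x‖ ^ 2) ^ (-(n : ℝ)) := by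
  have hn3 : (3 : ℝ) ≤ n := by exact_mod_cast hn
  have hn2 : (0 : ℝ) < n - 2 := by linarith
  rw [integral_one_add_norm_sq_rpow_neg (by linarith),
    integral_one_add_norm_sq_rpow_neg (by linarith)]
  have h1 : Gamma (n : ℝ) = (n - 1) * Gamma (n - 1) := by
    have := Gamma_add_one (s := (n : ℝ) - 1) (by linarith)
    rwa [sub_add_cancel] at this
  have h2 : Gamma ((n : ℝ) - n / 2) = (n / 2 - 1) * Gamma (n - 1 - n / 2) := by
    have := Gamma_add_one (s := (n : ℝ) - 1 - n / 2) (by linarith)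
    rw [show (n : ℝ) - n / 2 = n - 1 - n / 2 + 1 by ring, this]; ring
  have := Gamma_pos_of_pos (s := (n : ℝ) - 1) (by linarith)
  have h3 : (n : ℝ) - 1 ≠ 0 := by linarith
  rw [h1, h2]
  field_simp

theorem sobolev_of_forall_parameter {n E A m : ℝ} (hn : 2 < n) (hA : 0 < A) (hm : 0 ≤ m)
    (hE : 0 ≤ E)
    (h : ∀ k : ℝ, 0 < k → n * ((m / A) ^ (1 - 1 / n) * (2 * (n - 1) / (n - 2) * A)) ≤
      1 / (2 * k) * ((2 * (n - 1) / (n - 2)) ^ 2 * E) +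
      k / 2 * (m / A * (2 * (n - 1) / (n - 2) * A - A))) :
    n * (n - 2) * A ^ (2 / n) * m ^ ((n - 2) / n) ≤ E := by
  have hn2 : (0 : ℝ) < n - 2 := by linarith
  rcases hm.eq_or_lt with rfl | hm
  · rw [zero_rpow (by positivity), mul_zero]; exact hE
  set c := 2 * (n - 1) / (n - 2) with hc
  have hc0 : 0 < c := by have : 0 < n - 1 := by linarith
                         positivity
  have hn0 : (0 : ℝ) < n := by linarith
  set t : ℝ := (m / A) ^ (-(1 / n)) with ht
  have ht0 : 0 < t := by positivity
  have e1 : (m / A) ^ (1 - 1 / n) = m / A * t := by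
    rw [sub_eq_add_neg, rpow_add (by positivity), rpow_one]
  have e2 : m * t ^ 2 = A ^ (2 / n) * m ^ ((n - 2) / n) := by
    rw [ht, ← rpow_natCast, ← rpow_mul (by positivity), div_rpow hm.le hA.le]
    have a1 : -(1 / n) * ((2 : ℕ) : ℝ) = - (2 / n) := by push_cast; ring
    have a2 : (n - 2) / n = 1 + - (2 / n) := by field_simp; ring
    rw [a1, a2, rpow_add hm, rpow_one, rpow_neg hA.le]
    field_simp
  have hk := h (c * (n - 2) * t) (by positivity)
  rw [e1] at hk
  have e3 : c * A - A = n / (n - 2) * A := by rw [hc]; field_simp; ring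
  rw [e3] at hk
  have e4 : c * (n - 2) * t / 2 * (m / A * (n / (n - 2) * A)) = n * c * m * t / 2 := by
    field_simp
  have e5 : n * (m / A * t * (c * A)) = n * c * m * t := by field_simp
  have e6 : 1 / (2 * (c * (n - 2) * t)) * (c ^ 2 * E) = c * E / (2 * (n - 2) * t) := by field_simp
  rw [e4, e5, e6] at hk
  have hk2 : n * c * m * t / 2 ≤ c * E / (2 * (n - 2) * t) := by linarith
  rw [le_div_iff₀ (by positivity)] at hk2
  have : c * (n * (n - 2) * (m * t ^ 2)) ≤ c * E := by linarith
  rw [mul_assoc, ← e2]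
  exact le_of_mul_le_mul_left this hc0

theorem sobolev_euclideanSpace {n : ℕ} (hn : 3 ≤ n) {w : EuclideanSpace ℝ (Fin n) → ℝ}
    (hw : ContDiff ℝ 1 w) (hws : HasCompactSupport w) :
    sobolevConst n * (∫ x, |w x| ^ (2 * (n : ℝ) / (n - 2))) ^ (((n : ℝ) - 2) / n) ≤
      ∫ x, ‖gradient w x‖ ^ 2 := by
  have hn3 : (3 : ℝ) ≤ n := by exact_mod_cast hn
  have hn2 : (0 : ℝ) < n - 2 := by linarith
  have hn0 : (0 : ℝ) < n := by linarith
  have hmp := PiLp.volume_preserving_toLp (Fin n)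
  have hme := (MeasurableEquiv.toLp 2 (Fin n → ℝ)).measurableEmbedding
  have hInt : ∀ f : EuclideanSpace ℝ (Fin n) → ℝ,
      ∫ x : Fin n → ℝ, f (WithLp.toLp 2 x) = ∫ x, f x := fun f => hmp.integral_comp hme f
  have hintg : ∀ f : EuclideanSpace ℝ (Fin n) → ℝ, Integrable f →
      Integrable fun x : Fin n → ℝ => f (WithLp.toLp 2 x) := fun f hf =>
    (hmp.integrable_comp_emb hme).2 hf
  have hnorm : ∀ x : Fin n → ℝ, ‖WithLp.toLp 2 x‖ ^ 2 = ∑ i, x i ^ 2 := fun x => by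
    rw [EuclideanSpace.norm_sq_eq]; simp
  set e : Fin n → EuclideanSpace ℝ (Fin n) := fun i => EuclideanSpace.single i 1 with he
  have hfd : Continuous (fderiv ℝ w) := hw.continuous_fderiv one_ne_zero
  have htoLp : Continuous fun x : Fin n → ℝ => WithLp.toLp 2 x := PiLp.continuous_toLp 2 _
  have hgrad : ∀ x, ‖gradient w x‖ ^ 2 = ∑ i, fderiv ℝ w x (e i) ^ 2 := fun x => by
    rw [EuclideanSpace.norm_sq_eq]
    refine Finset.sum_congr rfl fun i _ => ?_
    have : fderiv ℝ w x (e i) = gradient w x i := by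
      rw [← toDual_gradient (𝕜 := ℝ), InnerProductSpace.toDual_apply_apply]
      simp only [he]; rw [EuclideanSpace.inner_single_right]; simp
    rw [this, Real.norm_eq_abs, sq_abs]
  set A := ∫ x : EuclideanSpace ℝ (Fin n), (1 + ‖x‖ ^ 2) ^ (-(n : ℝ)) with hA
  have hAval : A = π ^ ((n : ℝ) / 2) * (Gamma (n / 2) / Gamma n) := by
    rw [hA, integral_one_add_norm_sq_rpow_neg (by linarith)]
    congr 3; ring
  have hΓ1 := Gamma_pos_of_pos (s := (n : ℝ) / 2) (by positivity)
  have hΓ2 := Gamma_pos_of_pos (s := (n : ℝ)) (by positivity)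
  have hA0 : 0 < A := by rw [hAval]; positivity
  have hApi : ∫ x : Fin n → ℝ, (1 + ∑ i, x i ^ 2) ^ (-(n : ℝ)) = A := by
    rw [hA, ← hInt]; simp_rw [hnorm]
  have hBpi : ∫ x : Fin n → ℝ, (1 + ∑ i, x i ^ 2) ^ (-((n : ℝ) - 1)) =
      2 * ((n : ℝ) - 1) / (n - 2) * A := by
    rw [hA, ← integral_one_add_norm_sq_rpow_neg_sub_one hn, ← hInt]; simp_rw [hnorm]
  have hconst : sobolevConst n = n * (n - 2) * A ^ (2 / (n : ℝ)) := by
    rw [sobolevConst, hAval, mul_rpow (by positivity) (by positivity), ← rpow_mul pi_pos.le]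
    have : (n : ℝ) / 2 * (2 / n) = 1 := by field_simp
    rw [this, rpow_one]; ring
  rw [hconst]
  have hsupp : ∀ g : EuclideanSpace ℝ (Fin n) → ℝ, HasCompactSupport g →
      HasCompactSupport fun x : Fin n → ℝ => g (WithLp.toLp 2 x) := fun g hg =>
    hg.comp_homeomorph (PiLp.homeomorph 2 _).symm
  refine sobolev_of_forall_parameter (by linarith) hA0
    (integral_nonneg fun x => by positivity) (integral_nonneg fun x => by positivity) fun k hk => ?_
  have key := sobolev_pi hn (v := fun x => w (WithLp.toLp 2 x))
    (v' := fun i x => fderiv ℝ w (WithLp.toLp 2 x) (e i)) (hw.continuous.comp htoLp)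
    (fun i => (hfd.comp htoLp).clm_apply continuous_const) (hsupp _ hws)
    (fun i => hsupp (fun x => fderiv ℝ w x (e i)) (hws.fderiv_apply ℝ _))
    (fun i x => by
      have h1 : HasFDerivAt w (fderiv ℝ w (WithLp.toLp 2 x))
          (WithLp.toLp 2 (Function.update x i (x i))) := by
        rw [Function.update_eq_self]
        exact (hw.differentiable one_ne_zero _).hasFDerivAt
      have h2 : HasDerivAt (fun s => (WithLp.toLp 2 (Function.update x i s) :
          EuclideanSpace ℝ (Fin n))) (e i) (x i) := by
        have := hasDerivAt_update x i (x i)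
        exact (PiLp.continuousLinearEquiv 2 ℝ fun _ : Fin n => ℝ).symm.toContinuousLinearMap
          |>.hasFDerivAt.comp_hasDerivAt (x i) this
      exact h1.comp_hasDerivAt (x i) h2)
    (by simpa only [hnorm] using hintg _ (integrable_one_add_norm_sq_rpow_neg (n := n)
      (s := (n : ℝ)) (by linarith)))
    (by simpa only [hnorm] using hintg _ (integrable_one_add_norm_sq_rpow_neg (n := n)
      (s := (n : ℝ) - 1) (by linarith)))
    (by rw [hApi]; exact hA0) hk rfl rfl
  rw [hBpi, hApi, hInt (fun x => |w x| ^ (2 * (n : ℝ) / (n - 2))),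
    hInt (fun x => ∑ i, fderiv ℝ w x (e i) ^ 2)] at key
  simp_rw [hgrad]
  exact key

/-- The function `y ↦ y ^ (-k) * exp (-s * y ^ (-κ))` on `(0, ∞)`, extended by zero. -/
noncomputable def expNegRpow (s κ k y : ℝ) : ℝ :=
  if 0 < y then y ^ (-k) * exp (-s * y ^ (-κ)) else 0

theorem expNegRpow_of_pos {s κ k y : ℝ} (hy : 0 < y) :
    expNegRpow s κ k y = y ^ (-k) * exp (-s * y ^ (-κ)) := if_pos hy

theorem expNegRpow_of_nonpos {s κ k y : ℝ} (hy : y ≤ 0) : expNegRpow s κ k y = 0 :=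
  if_neg hy.not_gt

theorem tendsto_expNegRpow_zero {s κ : ℝ} (hs : 0 < s) (hκ : 0 < κ) (k : ℝ) :
    Tendsto (expNegRpow s κ k) (𝓝 0) (𝓝 0) := by
  have hle : Tendsto (expNegRpow s κ k) (𝓝[≤] 0) (𝓝 0) :=
    tendsto_const_nhds.congr' (by
      filter_upwards [self_mem_nhdsWithin] with y hy
      exact (expNegRpow_of_nonpos hy).symm)
  have hgt : Tendsto (expNegRpow s κ k) (𝓝[>] 0) (𝓝 0) := by
    have h1 := (tendsto_rpow_mul_exp_neg_mul_atTop_nhds_zero (k / κ) s hs).comp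
      (tendsto_rpow_neg_nhdsGT_zero (y := -κ) (by linarith))
    refine h1.congr' ?_
    filter_upwards [self_mem_nhdsWithin] with y hy
    have hy : 0 < y := hy
    rw [expNegRpow_of_pos hy, Function.comp, ← rpow_mul hy.le]
    congr 2
    field_simp
  have := hle.sup hgt
  rwa [← nhdsWithin_union, Iic_union_Ioi, nhdsWithin_univ] at this

theorem hasDerivAt_expNegRpow {s κ : ℝ} (hs : 0 < s) (hκ : 0 < κ) (k y : ℝ) :
    HasDerivAt (expNegRpow s κ k)
      (-k * expNegRpow s κ (k + 1) y + s * κ * expNegRpow s κ (k + κ + 1) y) y := by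
  rcases lt_trichotomy y 0 with hy | rfl | hy
  · rw [expNegRpow_of_nonpos hy.le, expNegRpow_of_nonpos hy.le, mul_zero, mul_zero, add_zero]
    refine (hasDerivAt_const y (0 : ℝ)).congr_of_eventuallyEq ?_
    filter_upwards [Iio_mem_nhds hy] with x hx
    exact expNegRpow_of_nonpos hx.le
  · rw [expNegRpow_of_nonpos le_rfl, expNegRpow_of_nonpos le_rfl, mul_zero, mul_zero, add_zero,
      hasDerivAt_iff_tendsto_slope]
    refine ((tendsto_expNegRpow_zero hs hκ (k + 1)).mono_left nhdsWithin_le_nhds).congr' ?_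
    filter_upwards [self_mem_nhdsWithin] with y hy
    rw [slope_def_field, expNegRpow_of_nonpos (le_refl (0 : ℝ)), sub_zero, sub_zero]
    rcases lt_or_gt_of_ne (show y ≠ 0 from hy) with h | h
    · rw [expNegRpow_of_nonpos h.le, expNegRpow_of_nonpos h.le, zero_div]
    · rw [expNegRpow_of_pos h, expNegRpow_of_pos h, neg_add, rpow_add h, rpow_neg_one]
      ring
  · have h1 : HasDerivAt (fun y : ℝ => y ^ (-k) * exp (-s * y ^ (-κ)))
        ((-k * y ^ (-k - 1)) * exp (-s * y ^ (-κ)) +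
          y ^ (-k) * (exp (-s * y ^ (-κ)) * (-s * (-κ * y ^ (-κ - 1))))) y :=
      (hasDerivAt_rpow_const (Or.inl hy.ne')).mul
        ((hasDerivAt_rpow_const (p := -κ) (Or.inl hy.ne')).const_mul (-s)).exp
    refine (h1.congr_deriv ?_).congr_of_eventuallyEq ?_
    · rw [expNegRpow_of_pos hy, expNegRpow_of_pos hy,
        show -(k + κ + 1) = -k + (-κ - 1) by ring, rpow_add hy,
        show -(k + 1) = -k - 1 by ring]
      ring
    · filter_upwards [Ioi_mem_nhds hy] with x hx
      exact expNegRpow_of_pos hx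

theorem contDiff_expNegRpow {s κ : ℝ} (hs : 0 < s) (hκ : 0 < κ) (k : ℝ) :
    ContDiff ℝ 1 (expNegRpow s κ k) := by
  have hc : ∀ k, Continuous (expNegRpow s κ k) := fun k =>
    continuous_iff_continuousAt.2 fun y => (hasDerivAt_expNegRpow hs hκ k y).continuousAt
  rw [contDiff_one_iff_deriv]
  refine ⟨fun y => (hasDerivAt_expNegRpow hs hκ k y).differentiableAt, ?_⟩
  rw [funext fun y => (hasDerivAt_expNegRpow hs hκ k y).deriv]
  exact (continuous_const.mul (hc _)).add (continuous_const.mul (hc _))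

section Polar

variable {E : Type*} [NormedAddCommGroup E] [NormedSpace ℝ E] [MeasurableSpace E] [Nontrivial E]
  (μ : Measure E) [FiniteDimensional ℝ E] [BorelSpace E] [μ.IsAddHaarMeasure]

theorem integral_volumeIoiPow (m : ℕ) (f : ℝ → ℝ) :
    ∫ r : Ioi (0 : ℝ), f r ∂Measure.volumeIoiPow m = ∫ r in Ioi (0 : ℝ), r ^ m * f r := by
  simp only [Measure.volumeIoiPow, ENNReal.ofReal]
  rw [integral_withDensity_eq_integral_smul (measurable_subtype_coe.pow_const _).real_toNNReal,
    integral_subtype_comap measurableSet_Ioi fun a ↦ Real.toNNReal (a ^ m) • f a]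
  refine setIntegral_congr_fun measurableSet_Ioi fun x hx => ?_
  simp only [NNReal.smul_def, Real.coe_toNNReal _ (pow_nonneg (le_of_lt hx) m), smul_eq_mul]

theorem integral_polar {f : E → ℝ} (hf : Integrable f μ) :
    Integrable (fun θ : Metric.sphere (0 : E) 1 =>
      ∫ r in Ioi (0 : ℝ), r ^ (Module.finrank ℝ E - 1) * f (r • (θ : E))) μ.toSphere ∧
    ∫ x, f x ∂μ = ∫ θ : Metric.sphere (0 : E) 1,
      (∫ r in Ioi (0 : ℝ), r ^ (Module.finrank ℝ E - 1) * f (r • (θ : E))) ∂μ.toSphere := by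
  set g : Metric.sphere (0 : E) 1 × Ioi (0 : ℝ) → ℝ := fun p => f (p.2.1 • (p.1 : E)) with hg
  have hme := (homeomorphUnitSphereProd E).measurableEmbedding
  have hmp := μ.measurePreserving_homeomorphUnitSphereProd
  have hgf : ∀ x : ({0}ᶜ : Set E), g (homeomorphUnitSphereProd E x) = f x := fun x => by
    have hx : ‖(x : E)‖ ≠ 0 := norm_ne_zero_iff.2 x.2
    simp only [hg, homeomorphUnitSphereProd_apply_fst_coe, homeomorphUnitSphereProd_apply_snd_coe]
    rw [smul_inv_smul₀ hx]
  have hgi : Integrable g (μ.toSphere.prod (Measure.volumeIoiPow (Module.finrank ℝ E - 1))) := by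
    rw [← hmp.integrable_comp_emb hme, Function.comp_def]
    simp_rw [hgf]
    have := (integrableOn_iff_comap_subtypeVal (μ := μ) (f := f) (s := ({0}ᶜ : Set E))
      (measurableSet_singleton _).compl).1 hf.integrableOn
    exact this
  have h1 : ∫ x, f x ∂μ =
      ∫ p, g p ∂(μ.toSphere.prod (Measure.volumeIoiPow (Module.finrank ℝ E - 1))) := by
    rw [← hmp.integral_comp hme]
    simp_rw [hgf]
    rw [integral_subtype_comap (measurableSet_singleton _).compl fun x ↦ f x,
        restrict_compl_singleton]
  have h2 : ∀ θ : Metric.sphere (0 : E) 1, ∫ r, g (θ, r) ∂Measure.volumeIoiPow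
      (Module.finrank ℝ E - 1) =
      ∫ r in Ioi (0 : ℝ), r ^ (Module.finrank ℝ E - 1) * f (r • (θ : E)) := fun θ =>
    integral_volumeIoiPow _ fun r => f (r • (θ : E))
  refine ⟨?_, ?_⟩
  · simpa only [h2] using hgi.integral_prod_left
  · rw [h1, integral_prod _ hgi]
    simp_rw [h2]

end Polar

/-- The change of variables `ρ ↦ exp (a - ρ ^ (-d) / d)`, with inverse
`r ↦ (d * (a - log r)) ^ (-1 / d)`. -/
noncomputable def radialExp (a d ρ : ℝ) : ℝ := exp (a - ρ ^ (-d) / d)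

theorem radialExp_pos (a d ρ : ℝ) : 0 < radialExp a d ρ := exp_pos _

theorem hasDerivAt_radialExp {a d ρ : ℝ} (hd : 0 < d) (hρ : 0 < ρ) :
    HasDerivAt (radialExp a d) (radialExp a d ρ * ρ ^ (-d - 1)) ρ := by
  have h1 := (((hasDerivAt_rpow_const (p := -d) (Or.inl hρ.ne')).div_const d).const_sub a).exp
  refine h1.congr_deriv ?_
  rw [radialExp]
  field_simp

theorem radialExp_lt_iff {a d x y : ℝ} (hd : 0 < d) (hx : 0 < x) (hy : 0 < y) :
    radialExp a d x < radialExp a d y ↔ x < y := by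
  rw [radialExp, radialExp, exp_lt_exp, sub_lt_sub_iff_left, div_lt_div_iff_of_pos_right hd,
    rpow_lt_rpow_iff_of_neg hy hx (by linarith)]

theorem injOn_radialExp {a d : ℝ} (hd : 0 < d) (b : ℝ) : InjOn (radialExp a d) (Ioo 0 b) := by
  intro x hx y hy hxy
  by_contra hne
  rcases lt_or_gt_of_ne hne with h | h
  · exact ((radialExp_lt_iff hd hx.1 hy.1).2 h).ne hxy
  · exact ((radialExp_lt_iff hd hy.1 hx.1).2 h).ne' hxy

theorem setIntegral_Ioi_eq_Ioo {b : ℝ} {f : ℝ → ℝ} (hf : ∀ x, b ≤ x → f x = 0) :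
    ∫ x in Ioi (0 : ℝ), f x = ∫ x in Ioo 0 b, f x := by
  refine setIntegral_eq_of_subset_of_forall_sdiff_eq_zero measurableSet_Ioi
    Ioo_subset_Ioi_self fun x hx => hf x ?_
  by_contra h
  exact hx.2 ⟨hx.1, not_le.1 h⟩

theorem radialExp_endpoint {a d : ℝ} (hd : 0 < d) (ha : 0 < a) :
    radialExp a d ((d * a) ^ (-(1 / d))) = 1 := by
  have : (0 : ℝ) < d * a := by positivity
  rw [radialExp, ← rpow_mul this.le, show -(1 / d) * -d = 1 by field_simp, rpow_one,
    mul_div_cancel_left₀ _ hd.ne', sub_self, exp_zero]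

theorem radialExp_image {a d : ℝ} (hd : 0 < d) (ha : 0 < a) :
    radialExp a d '' Ioo 0 ((d * a) ^ (-(1 / d))) = Ioo 0 1 := by
  have hda : (0 : ℝ) < d * a := by positivity
  have hR : 0 < (d * a) ^ (-(1 / d)) := by positivity
  ext r
  constructor
  · rintro ⟨ρ, hρ, rfl⟩
    refine ⟨radialExp_pos _ _ _, ?_⟩
    rw [← radialExp_endpoint hd ha, radialExp_lt_iff hd hρ.1 hR]
    exact hρ.2
  · rintro ⟨h0, h1⟩
    have hl : log r < 0 := log_neg h0 h1
    have hp : 0 < d * (a - log r) := by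
      have : 0 < a - log r := by linarith
      positivity
    have hr : radialExp a d ((d * (a - log r)) ^ (-(1 / d))) = r := by
      rw [radialExp, ← rpow_mul hp.le, show -(1 / d) * -d = 1 by field_simp, rpow_one,
        mul_div_cancel_left₀ _ hd.ne', sub_sub_cancel, exp_log h0]
    refine ⟨_, ⟨by positivity, ?_⟩, hr⟩
    rw [← radialExp_lt_iff (a := a) hd (by positivity) hR, hr, radialExp_endpoint hd ha]
    exact h1

theorem setIntegral_radialExp {a d : ℝ} (hd : 0 < d) (ha : 0 < a) (F : ℝ → ℝ) :
    ∫ ρ in Ioo 0 ((d * a) ^ (-(1 / d))),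
      radialExp a d ρ * ρ ^ (-d - 1) * F (radialExp a d ρ) = ∫ r in Ioo 0 1, F r := by
  rw [← radialExp_image hd ha, integral_image_eq_integral_abs_deriv_smul measurableSet_Ioo
    (fun ρ hρ => (hasDerivAt_radialExp hd hρ.1).hasDerivWithinAt)
    (injOn_radialExp hd _)]
  refine setIntegral_congr_fun measurableSet_Ioo fun ρ hρ => ?_
  have h1 := radialExp_pos a d ρ
  have h2 := rpow_pos_of_pos hρ.1 (-d - 1)
  simp only [smul_eq_mul]
  rw [abs_of_pos (mul_pos h1 h2)]

theorem integrableOn_radialExp {a d : ℝ} (hd : 0 < d) (ha : 0 < a) {F : ℝ → ℝ}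
    (hF : IntegrableOn F (Ioo 0 1)) :
    IntegrableOn (fun ρ => radialExp a d ρ * ρ ^ (-d - 1) * F (radialExp a d ρ))
      (Ioo 0 ((d * a) ^ (-(1 / d)))) := by
  rw [← radialExp_image hd ha, integrableOn_image_iff_integrableOn_abs_deriv_smul measurableSet_Ioo
    (fun ρ hρ => (hasDerivAt_radialExp hd hρ.1).hasDerivWithinAt)
    (injOn_radialExp hd _)] at hF
  refine hF.congr_fun (fun ρ hρ => ?_) measurableSet_Ioo
  have h1 := radialExp_pos a d ρ
  have h2 := rpow_pos_of_pos hρ.1 (-d - 1)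
  simp only [smul_eq_mul]
  rw [abs_of_pos (mul_pos h1 h2)]

theorem integral_ray_hardy {n : ℕ} (hn : 3 ≤ n) {U U' : ℝ → ℝ}
    (hU : ∀ r, HasDerivAt U (U' r) r) (hU' : Continuous U') (h1 : U 1 = 0) :
    ∫ r in Ioo (0 : ℝ) 1, (2 * U r * U' r * r ^ (n - 2) + ((n : ℝ) - 2) * (r ^ (n - 3) * U r ^ 2)) =
      0 := by
  have hUc : Continuous U := continuous_iff_continuousAt.2 fun r => (hU r).continuousAt
  have hcast : ((n - 2 : ℕ) : ℝ) = (n : ℝ) - 2 := by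
    push_cast [Nat.cast_sub (show 2 ≤ n by omega)]; ring
  have hder : ∀ r ∈ uIcc (0 : ℝ) 1, HasDerivAt (fun r => U r ^ 2 * r ^ (n - 2))
      (2 * U r * U' r * r ^ (n - 2) + ((n : ℝ) - 2) * (r ^ (n - 3) * U r ^ 2)) r := fun r _ => by
    refine (((hU r).pow 2).mul (hasDerivAt_pow (n - 2) r)).congr_deriv ?_
    rw [hcast, show n - 2 - 1 = n - 3 by omega]
    simp only [Nat.cast_ofNat, Pi.pow_apply]
    ring
  have := intervalIntegral.integral_eq_sub_of_hasDerivAt hder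
    (Continuous.intervalIntegrable (by fun_prop) _ _)
  rw [intervalIntegral.integral_of_le zero_le_one, integral_Ioc_eq_integral_Ioo] at this
  rw [this, h1, zero_pow (show n - 2 ≠ 0 by omega)]
  ring

theorem integral_ray_gradient_le {n : ℕ} (hn : 3 ≤ n) {a : ℝ} (ha : 0 < a) {U U' G K : ℝ → ℝ}
    (hU : ∀ r, HasDerivAt U (U' r) r) (hU' : Continuous U') (hU1 : ∀ r, 1 ≤ r → U r = 0)
    (hG : Continuous G) (hG1 : ∀ r, 1 ≤ r → G r = 0) (hK0 : ∀ ρ, 0 ≤ K ρ)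
    (hK1 : ∀ ρ, (((n : ℝ) - 2) * a) ^ (-(1 / ((n : ℝ) - 2))) ≤ ρ → K ρ = 0)
    (hK : ∀ ρ, 0 < ρ → ρ < (((n : ℝ) - 2) * a) ^ (-(1 / ((n : ℝ) - 2))) →
      ρ ^ (n - 1) * K ρ ≤
        radialExp a ((n : ℝ) - 2) ρ * ρ ^ (-((n : ℝ) - 2) - 1) *
        (fun r => r ^ (n - 1) * G r + ((n : ℝ) - 2) * (U r * U' r * r ^ (n - 2)) +
          (((n : ℝ) - 2) / 2) ^ 2 * (r ^ (n - 3) * U r ^ 2)) (radialExp a ((n : ℝ) - 2) ρ)) :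
    ∫ ρ in Ioi (0 : ℝ), ρ ^ (n - 1) * K ρ ≤
      (∫ r in Ioi (0 : ℝ), r ^ (n - 1) * G r) -
        (((n : ℝ) - 2) / 2) ^ 2 * ∫ r in Ioi (0 : ℝ), r ^ (n - 1) * (U r ^ 2 / r ^ 2) := by
  have hd : (0 : ℝ) < n - 2 := by
    have : (3 : ℝ) ≤ n := by exact_mod_cast hn
    linarith
  set d : ℝ := (n : ℝ) - 2 with hd_def
  have hUc : Continuous U := continuous_iff_continuousAt.2 fun r => (hU r).continuousAt
  have hInt : ∀ {f : ℝ → ℝ}, Continuous f → IntegrableOn f (Ioo 0 1) := fun hf =>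
    (hf.continuousOn.integrableOn_Icc (a := 0) (b := 1)).mono_set Ioo_subset_Icc_self
  rw [setIntegral_Ioi_eq_Ioo (fun ρ hρ => by rw [hK1 ρ hρ, mul_zero]),
    setIntegral_Ioi_eq_Ioo (b := 1) (fun r hr => by rw [hG1 r hr, mul_zero]),
    setIntegral_Ioi_eq_Ioo (b := 1) (fun r hr => by rw [hU1 r hr]; simp)]
  set F : ℝ → ℝ := fun r => r ^ (n - 1) * G r + d * (U r * U' r * r ^ (n - 2)) +
    (d / 2) ^ 2 * (r ^ (n - 3) * U r ^ 2) with hF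
  have i1 : IntegrableOn (fun r => r ^ (n - 1) * G r) (Ioo 0 1) := hInt (by fun_prop)
  have i2 : IntegrableOn (fun r => 2 * U r * U' r * r ^ (n - 2) + d * (r ^ (n - 3) * U r ^ 2))
    (Ioo 0 1) := hInt (by fun_prop)
  have i3 : IntegrableOn (fun r => r ^ (n - 3) * U r ^ 2) (Ioo 0 1) := hInt (by fun_prop)
  have hH := integral_ray_hardy hn hU hU' (hU1 1 le_rfl)
  have hFint : ∫ r in Ioo 0 1, F r = (∫ r in Ioo 0 1, r ^ (n - 1) * G r) -
      (d / 2) ^ 2 * ∫ r in Ioo 0 1, r ^ (n - 3) * U r ^ 2 := by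
    have e : ∀ r, F r = (r ^ (n - 1) * G r - (d / 2) ^ 2 * (r ^ (n - 3) * U r ^ 2)) +
        d / 2 * (2 * U r * U' r * r ^ (n - 2) + d * (r ^ (n - 3) * U r ^ 2)) := fun r => by
      simp only [hF]; ring
    simp_rw [e]
    have i4 : IntegrableOn (fun r => r ^ (n - 1) * G r - (d / 2) ^ 2 * (r ^ (n - 3) * U r ^ 2))
      (Ioo 0 1) := i1.sub (i3.const_mul _)
    rw [integral_add i4 (i2.const_mul _), integral_sub i1 (i3.const_mul _), integral_const_mul,
      integral_const_mul, hH]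
    ring
  have hU2 : ∫ r in Ioo (0 : ℝ) 1, r ^ (n - 1) * (U r ^ 2 / r ^ 2) =
      ∫ r in Ioo (0 : ℝ) 1, r ^ (n - 3) * U r ^ 2 := by
    refine setIntegral_congr_fun measurableSet_Ioo fun r hr => ?_
    have : r ≠ 0 := hr.1.ne'
    rw [show n - 1 = n - 3 + 2 by omega, pow_add]
    field_simp
  rw [hU2, ← hFint, ← setIntegral_radialExp hd ha F]
  refine integral_mono_of_nonneg ?_ (integrableOn_radialExp hd ha (hInt (by fun_prop))) ?_
  · filter_upwards [ae_restrict_mem measurableSet_Ioo] with ρ hρ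
    exact mul_nonneg (pow_nonneg hρ.1.le _) (hK0 ρ)
  · filter_upwards [ae_restrict_mem measurableSet_Ioo] with ρ hρ
    exact hK ρ hρ.1 hρ.2

theorem integral_ray_rpow_eq {n : ℕ} (hn : 3 ≤ n) {a : ℝ} (ha : 0 < a) {U W : ℝ → ℝ}
    (hU1 : ∀ r, 1 ≤ r → U r = 0)
    (hW1 : ∀ ρ, (((n : ℝ) - 2) * a) ^ (-(1 / ((n : ℝ) - 2))) ≤ ρ → W ρ = 0)
    (hW : ∀ ρ, 0 < ρ → W ρ = radialExp a ((n : ℝ) - 2) ρ ^ (((n : ℝ) - 2) / 2) *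
      U (radialExp a ((n : ℝ) - 2) ρ)) :
    ∫ r in Ioi (0 : ℝ), r ^ (n - 1) * (((a - log r)⁻¹) ^ (2 * ((n : ℝ) - 1) / (n - 2)) *
        |U r| ^ (2 * (n : ℝ) / (n - 2))) =
      ((n : ℝ) - 2) ^ (2 * ((n : ℝ) - 1) / (n - 2)) *
        ∫ ρ in Ioi (0 : ℝ), ρ ^ (n - 1) * |W ρ| ^ (2 * (n : ℝ) / (n - 2)) := by
  have hd : (0 : ℝ) < n - 2 := by
    have : (3 : ℝ) ≤ n := by exact_mod_cast hn
    linarith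
  have hq : (0 : ℝ) < 2 * (n : ℝ) / (n - 2) := by
    have : (3 : ℝ) ≤ n := by exact_mod_cast hn
    positivity
  have hn1 : ((n - 1 : ℕ) : ℝ) = (n : ℝ) - 1 := by
    push_cast [Nat.cast_sub (show 1 ≤ n by omega)]; ring
  rw [setIntegral_Ioi_eq_Ioo (b := 1) (fun r hr =>
    by rw [hU1 r hr, abs_zero, zero_rpow hq.ne']; simp),
    setIntegral_Ioi_eq_Ioo
      (fun ρ hρ => by rw [hW1 ρ hρ, abs_zero, zero_rpow hq.ne', mul_zero]),
    ← setIntegral_radialExp hd ha, ← integral_const_mul]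
  refine setIntegral_congr_fun measurableSet_Ioo fun ρ hρ => ?_
  have hρ0 := hρ.1
  have hr := radialExp_pos a ((n : ℝ) - 2) ρ
  have hX : (a - log (radialExp a ((n : ℝ) - 2) ρ))⁻¹ = ((n : ℝ) - 2) * ρ ^ ((n : ℝ) - 2) := by
    rw [radialExp, log_exp, sub_sub_cancel, rpow_neg hρ0.le, inv_div, div_inv_eq_mul]
  rw [hX, hW ρ hρ0, abs_mul, abs_of_pos (rpow_pos_of_pos hr _),
    mul_rpow (rpow_nonneg hr.le _) (abs_nonneg _), mul_rpow hd.le (rpow_nonneg hρ0.le _),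
    ← rpow_mul hr.le, ← rpow_mul hρ0.le]
  have e1 : ((n : ℝ) - 2) / 2 * (2 * n / (n - 2)) = 1 + ((n - 1 : ℕ) : ℝ) := by
    rw [hn1]; field_simp; ring
  have e2 : ((n : ℝ) - 2) * (2 * (n - 1) / (n - 2)) = ((n - 1 : ℕ) : ℝ) + ((n - 1 : ℕ) : ℝ) := by
    rw [hn1]; field_simp; ring
  have e3 : -((n : ℝ) - 2) - 1 = -((n - 1 : ℕ) : ℝ) := by rw [hn1]; ring
  rw [e1, e2, e3, rpow_add hr, rpow_add hρ0, rpow_neg hρ0.le, rpow_natCast, rpow_natCast, rpow_one]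
  have : ρ ^ (n - 1) ≠ 0 := (pow_pos hρ0 _).ne'
  field_simp

section RadialTransform

variable {E : Type*} [NormedAddCommGroup E] [InnerProductSpace ℝ E]

/-- The function `z ↦ r ^ (d / 2) * u (r * z / ‖z‖)` with `r = exp (a - ‖z‖ ^ (-d) / d)`. -/
noncomputable def radialTransform (a d : ℝ) (u : E → ℝ) (z : E) : ℝ :=
  (exp (a * (d / 2)) * expNegRpow (1 / 2) (d / 2) 0 (‖z‖ ^ 2)) *
    u ((exp a * expNegRpow (1 / d) (d / 2) (1 / 2) (‖z‖ ^ 2)) • z)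

theorem contDiff_radialTransform {a d : ℝ} (hd : 0 < d) {u : E → ℝ} (hu : ContDiff ℝ 1 u) :
    ContDiff ℝ 1 (radialTransform a d u) := by
  have h1 : ContDiff ℝ 1 fun z : E => ‖z‖ ^ 2 := contDiff_norm_sq ℝ
  have h2 := (contDiff_expNegRpow (s := 1 / 2) (κ := d / 2) (by norm_num) (by positivity) 0).comp h1
  have h3 := (contDiff_expNegRpow (s := 1 / d) (κ := d / 2) (by positivity) (by positivity)
    (1 / 2)).comp h1
  exact (contDiff_const.mul h2).mul (hu.comp ((contDiff_const.mul h3).smul contDiff_id))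

theorem expNegRpow_sq {s d k ρ : ℝ} (hρ : 0 < ρ) :
    expNegRpow s (d / 2) k (ρ ^ 2) = ρ ^ (-(2 * k)) * exp (-s * ρ ^ (-d)) := by
  rw [expNegRpow_of_pos (by positivity), ← rpow_natCast, ← rpow_mul hρ.le, ← rpow_mul hρ.le]
  congr 2
  · push_cast; ring
  · congr 2; push_cast; ring

theorem radialExp_eq_mul {a d ρ : ℝ} :
    radialExp a d ρ = exp a * exp (-(1 / d) * ρ ^ (-d)) := by
  rw [radialExp, ← exp_add]; congr 1; ring

theorem radialExp_rpow_eq_mul {a d ρ : ℝ} (hd : 0 < d) :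
    radialExp a d ρ ^ (d / 2) = exp (a * (d / 2)) * exp (-(1 / 2) * ρ ^ (-d)) := by
  rw [radialExp, ← exp_mul, ← exp_add]; congr 1; field_simp; ring

theorem radialTransform_smul {a d ρ : ℝ} (hd : 0 < d) (hρ : 0 < ρ) {θ : E} (hθ : ‖θ‖ = 1)
    (u : E → ℝ) : radialTransform a d u (ρ • θ) =
      radialExp a d ρ ^ (d / 2) * u (radialExp a d ρ • θ) := by
  have hz : ‖ρ • θ‖ = ρ := by rw [norm_smul, hθ, mul_one, norm_of_nonneg hρ.le]
  rw [radialTransform, hz, expNegRpow_sq hρ, expNegRpow_sq hρ, radialExp_rpow_eq_mul hd, smul_smul,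
    radialExp_eq_mul]
  have e1 : ρ ^ (-(2 * (0 : ℝ))) = 1 := by norm_num
  have e2 : ρ ^ (-(2 * (1 / 2 : ℝ))) = ρ⁻¹ := by
    rw [show -(2 * (1 / 2 : ℝ)) = -1 by norm_num, rpow_neg_one]
  rw [e1, e2]
  congr 3
  · ring
  · field_simp

theorem radialTransform_eq_zero {a d : ℝ} (hd : 0 < d) (ha : 0 < a) {u : E → ℝ}
    (hu : ∀ x, 1 ≤ ‖x‖ → u x = 0) {z : E} (hz : (d * a) ^ (-(1 / d)) ≤ ‖z‖) :
    radialTransform a d u z = 0 := by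
  have hR : 0 < (d * a) ^ (-(1 / d)) := by positivity
  have hz0 : 0 < ‖z‖ := hR.trans_le hz
  have hθ : ‖(‖z‖⁻¹ • z)‖ = 1 := by
    rw [norm_smul, norm_inv, norm_norm, inv_mul_cancel₀ hz0.ne']
  have := radialTransform_smul (a := a) hd hz0 hθ u
  rw [smul_inv_smul₀ hz0.ne'] at this
  rw [this, hu, mul_zero]
  rw [norm_smul, hθ, mul_one, norm_of_nonneg (radialExp_pos _ _ _).le, ← not_lt,
    ← radialExp_endpoint hd ha, radialExp_lt_iff hd hz0 hR]
  exact not_lt.2 hz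

theorem norm_smul_add_smul_sq {α β : ℝ} {g θ : E} (hθ : ‖θ‖ = 1) :
    ‖α • g + β • θ‖ ^ 2 =
      α ^ 2 * (‖g‖ ^ 2 - inner ℝ g θ ^ 2) + (α * inner ℝ g θ + β) ^ 2 := by
  rw [norm_add_sq_real, norm_smul, norm_smul, hθ, inner_smul_left, inner_smul_right, mul_pow,
    mul_pow, norm_eq_abs, norm_eq_abs, sq_abs, sq_abs]
  simp only [conj_trivial]
  ring

variable [CompleteSpace E]

theorem hasGradientAt_mul_comp_norm_sq {M N : ℝ → ℝ} {M' N' : ℝ} {u : E → ℝ} {g z : E}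
    (hM : HasDerivAt M M' (‖z‖ ^ 2)) (hN : HasDerivAt N N' (‖z‖ ^ 2))
    (hu : HasGradientAt u g (N (‖z‖ ^ 2) • z)) :
    HasGradientAt (fun z => M (‖z‖ ^ 2) * u (N (‖z‖ ^ 2) • z))
      ((M (‖z‖ ^ 2) * N (‖z‖ ^ 2)) • g +
        (2 * M' * u (N (‖z‖ ^ 2) • z) + 2 * M (‖z‖ ^ 2) * N' * inner ℝ g z) • z) z := by
  have hs : HasFDerivAt (fun z : E => ‖z‖ ^ 2) (2 • innerSL ℝ z) z := hasFDerivAt_id z |>.norm_sq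
  have h1 := hM.comp_hasFDerivAt z hs
  have h2 := hN.comp_hasFDerivAt z hs
  have h3 : HasFDerivAt (fun z => N (‖z‖ ^ 2) • z) _ z := h2.smul (hasFDerivAt_id z)
  have h4 : HasFDerivAt (fun z => u (N (‖z‖ ^ 2) • z)) _ z :=
    HasFDerivAt.comp (g := u) (f := fun z => N (‖z‖ ^ 2) • z) z hu.hasFDerivAt h3
  have h5 : HasFDerivAt (fun z => M (‖z‖ ^ 2) * u (N (‖z‖ ^ 2) • z)) _ z := h1.mul h4
  rw [hasGradientAt_iff_hasFDerivAt]
  refine h5.congr_fderiv ?_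
  ext h
  simp
  ring

theorem norm_gradient_radialTransform_sq {a d ρ : ℝ} (hd : 0 < d) (hρ : 0 < ρ) {θ : E}
    (hθ : ‖θ‖ = 1) {u : E → ℝ} (hu : Differentiable ℝ u) :
    ‖gradient (radialTransform a d u) (ρ • θ)‖ ^ 2 =
      (radialExp a d ρ ^ (d / 2) * (radialExp a d ρ / ρ)) ^ 2 *
        (‖gradient u (radialExp a d ρ • θ)‖ ^ 2 -
          inner ℝ (gradient u (radialExp a d ρ • θ)) θ ^ 2) +
      (radialExp a d ρ ^ (d / 2) * ρ ^ (-d - 1) *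
        (radialExp a d ρ * inner ℝ (gradient u (radialExp a d ρ • θ)) θ +
          d / 2 * u (radialExp a d ρ • θ))) ^ 2 := by
  have hz : ‖ρ • θ‖ = ρ := by rw [norm_smul, hθ, mul_one, norm_of_nonneg hρ.le]
  have hM := (hasDerivAt_expNegRpow (s := 1 / 2) (κ := d / 2) (by norm_num) (by positivity) 0
    (‖ρ • θ‖ ^ 2)).const_mul (exp (a * (d / 2)))
  have hN := (hasDerivAt_expNegRpow (s := 1 / d) (κ := d / 2) (by positivity) (by positivity)
    (1 / 2)
    (‖ρ • θ‖ ^ 2)).const_mul (exp a)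
  have key := (hasGradientAt_mul_comp_norm_sq hM hN (hu _).hasGradientAt).gradient
  have eM : exp (a * (d / 2)) * expNegRpow (1 / 2) (d / 2) 0 (‖ρ • θ‖ ^ 2) =
      radialExp a d ρ ^ (d / 2) := by
    rw [hz, expNegRpow_sq hρ, radialExp_rpow_eq_mul hd]; norm_num
  have eN : exp a * expNegRpow (1 / d) (d / 2) (1 / 2) (‖ρ • θ‖ ^ 2) = radialExp a d ρ / ρ := by
    rw [hz, expNegRpow_sq hρ, radialExp_eq_mul,
      show -(2 * (1 / 2 : ℝ)) = -1 by norm_num, rpow_neg_one]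
    field_simp
  have eM' : exp (a * (d / 2)) * (-0 * expNegRpow (1 / 2) (d / 2) (0 + 1) (‖ρ • θ‖ ^ 2) +
      1 / 2 * (d / 2) * expNegRpow (1 / 2) (d / 2) (0 + d / 2 + 1) (‖ρ • θ‖ ^ 2)) =
      d / 4 * radialExp a d ρ ^ (d / 2) * (ρ ^ (-d - 1) / ρ) := by
    rw [hz, expNegRpow_sq hρ, expNegRpow_sq hρ, radialExp_rpow_eq_mul hd,
      show -(2 * (0 + d / 2 + 1)) = -d - 1 - 1 by ring, rpow_sub_one hρ.ne' (-d - 1)]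
    ring
  have eN' : exp a * (-(1 / 2) * expNegRpow (1 / d) (d / 2) (1 / 2 + 1) (‖ρ • θ‖ ^ 2) +
      1 / d * (d / 2) * expNegRpow (1 / d) (d / 2) (1 / 2 + d / 2 + 1) (‖ρ • θ‖ ^ 2)) =
      radialExp a d ρ / 2 * (ρ ^ (-d - 1) / ρ ^ 2 - 1 / ρ ^ 3) := by
    rw [hz, expNegRpow_sq hρ, expNegRpow_sq hρ, radialExp_eq_mul,
      show -(2 * (1 / 2 + d / 2 + 1)) = -d - 1 - ((2 : ℕ) : ℝ) by push_cast; ring,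
      rpow_sub_natCast hρ.ne' (-d - 1), show -(2 * (1 / 2 + 1 : ℝ)) = -((3 : ℕ) : ℝ) by norm_num,
      rpow_neg hρ.le, rpow_natCast]
    field_simp
    ring
  rw [eM, eN, eM', eN', smul_smul, div_mul_cancel₀ _ hρ.ne', smul_smul] at key
  have key' : gradient (radialTransform a d u) (ρ • θ) = _ := key
  rw [key', norm_smul_add_smul_sq hθ, inner_smul_right]
  congr 2
  field_simp
  ring

theorem pow_mul_norm_gradient_radialTransform_sq_le {n : ℕ} (hn : 3 ≤ n) {a ρ : ℝ} (hρ : 0 < ρ)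
    (hρ1 : ρ ≤ 1) {θ : E} (hθ : ‖θ‖ = 1) {u : E → ℝ} (hu : Differentiable ℝ u) :
    ρ ^ (n - 1) * ‖gradient (radialTransform a ((n : ℝ) - 2) u) (ρ • θ)‖ ^ 2 ≤
      radialExp a ((n : ℝ) - 2) ρ * ρ ^ (-((n : ℝ) - 2) - 1) *
        (fun r : ℝ => r ^ (n - 1) * ‖gradient u (r • θ)‖ ^ 2 +
          ((n : ℝ) - 2) * (u (r • θ) * inner ℝ (gradient u (r • θ)) θ * r ^ (n - 2)) +
          (((n : ℝ) - 2) / 2) ^ 2 * (r ^ (n - 3) * u (r • θ) ^ 2))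
          (radialExp a ((n : ℝ) - 2) ρ) := by
  have hd : (0 : ℝ) < n - 2 := by
    have : (3 : ℝ) ≤ n := by exact_mod_cast hn
    linarith
  rw [norm_gradient_radialTransform_sq hd hρ hθ hu]
  have hn1 : ((n - 1 : ℕ) : ℝ) = (n : ℝ) - 1 := by
    push_cast [Nat.cast_sub (show 1 ≤ n by omega)]; ring
  have hn2 : ((n - 2 : ℕ) : ℝ) = (n : ℝ) - 2 := by
    push_cast [Nat.cast_sub (show 2 ≤ n by omega)]; ring
  have e3 : -((n : ℝ) - 2) - 1 = -((n - 1 : ℕ) : ℝ) := by rw [hn1]; ring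
  rw [e3, rpow_neg hρ.le, rpow_natCast]
  set r := radialExp a ((n : ℝ) - 2) ρ with hr
  have hr0 : 0 < r := radialExp_pos _ _ _
  have hm : (r ^ (((n : ℝ) - 2) / 2)) ^ 2 = r ^ (n - 3) * r := by
    rw [← pow_succ, show n - 3 + 1 = n - 2 by omega, ← rpow_natCast _ 2, ← rpow_mul hr0.le,
      ← rpow_natCast r (n - 2), hn2]
    congr 1; push_cast; ring
  set g := gradient u (r • θ)
  set p : ℝ := inner ℝ g θ
  set v := u (r • θ)
  have hp : p ^ 2 ≤ ‖g‖ ^ 2 := by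
    have := abs_real_inner_le_norm g θ
    rw [hθ, mul_one] at this
    exact sq_le_sq' (by linarith [neg_abs_le p]) ((le_abs_self p).trans this)
  set P := ρ ^ (n - 1) with hP
  have hP0 : 0 < P := by positivity
  have hPρ : P ≤ ρ := pow_le_of_le_one hρ.le hρ1 (by omega)
  have e1 : r ^ (n - 1) = r ^ (n - 3) * r ^ 2 := by rw [← pow_add]; congr 1; omega
  have e2 : r ^ (n - 2) = r ^ (n - 3) * r := by rw [← pow_succ]; congr 1; omega
  simp only [mul_pow, hm, e1, e2]
  have hfac : P * (r / ρ) ^ 2 ≤ r ^ 2 * P⁻¹ := by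
    rw [div_pow, ← div_eq_mul_inv, le_div_iff₀ hP0, mul_div_assoc', div_mul_eq_mul_div,
      div_le_iff₀ (by positivity)]
    have : P ^ 2 ≤ ρ ^ 2 := by gcongr
    nlinarith [sq_nonneg r]
  have h4 := mul_le_mul_of_nonneg_left hfac
    (mul_nonneg (mul_nonneg (pow_nonneg hr0.le (n - 3)) hr0.le) (sub_nonneg.2 hp))
  have e5 : P * (r ^ (n - 3) * r * P⁻¹ ^ 2 * (r * p + ((n : ℝ) - 2) / 2 * v) ^ 2) =
      r ^ (n - 3) * r * P⁻¹ * (r * p + ((n : ℝ) - 2) / 2 * v) ^ 2 := by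
    field_simp
  rw [mul_add, e5]
  nlinarith [h4]

end RadialTransform

theorem integral_norm_gradient_radialTransform_sq_le {n : ℕ} (hn : 3 ≤ n) {a : ℝ}
    (ha : 1 / ((n : ℝ) - 2) ≤ a) {u : EuclideanSpace ℝ (Fin n) → ℝ} (hu : ContDiff ℝ 1 u)
    (hus : HasCompactSupport u) (hu1 : ∀ x, 1 ≤ ‖x‖ → u x = 0)
    (hg1 : ∀ x, 1 ≤ ‖x‖ → gradient u x = 0)
    (hws : HasCompactSupport (radialTransform a ((n : ℝ) - 2) u)) :
    ∫ z, ‖gradient (radialTransform a ((n : ℝ) - 2) u) z‖ ^ 2 ≤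
      (∫ x, ‖gradient u x‖ ^ 2) - (((n : ℝ) - 2) / 2) ^ 2 * ∫ x, u x ^ 2 / ‖x‖ ^ 2 := by
  have hn3 : (3 : ℝ) ≤ n := by exact_mod_cast hn
  have hd : (0 : ℝ) < n - 2 := by linarith
  have ha0 : 0 < a := lt_of_lt_of_le (by positivity) ha
  have : NeZero n := ⟨by omega⟩
  have : Nontrivial (EuclideanSpace ℝ (Fin n)) := inferInstance
  set w := radialTransform a ((n : ℝ) - 2) u with hwdef
  have hw : ContDiff ℝ 1 w := contDiff_radialTransform hd hu
  have hgi : ∀ f : EuclideanSpace ℝ (Fin n) → ℝ, ContDiff ℝ 1 f → HasCompactSupport f →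
      Continuous (gradient f) ∧ Integrable fun x => ‖gradient f x‖ ^ 2 := fun f hf hfs => by
    have hc : Continuous (gradient f) :=
      (InnerProductSpace.toDual ℝ _).symm.continuous.comp (hf.continuous_fderiv one_ne_zero)
    have hs : HasCompactSupport (gradient f) :=
      (hfs.fderiv ℝ).comp_left (g := (InnerProductSpace.toDual ℝ _).symm) (map_zero _)
    have hs2 : HasCompactSupport fun x => ‖gradient f x‖ ^ 2 :=
      hs.comp_left (g := fun v : EuclideanSpace ℝ (Fin n) => ‖v‖ ^ 2) (by simp)
    have hc2 : Continuous fun x => ‖gradient f x‖ ^ 2 := by fun_prop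
    exact ⟨hc, hc2.integrable_of_hasCompactSupport hs2⟩
  obtain ⟨hugc, hugi⟩ := hgi u hu hus
  obtain ⟨hwgc, hwgi⟩ := hgi w hw hws
  have hdim : Module.finrank ℝ (EuclideanSpace ℝ (Fin n)) = n := by simp
  have hhardy : Integrable fun x => u x ^ 2 / ‖x‖ ^ 2 := by
    obtain ⟨C, hC⟩ := hus.exists_bound_of_continuous hu.continuous
    have h1 : IntegrableOn (fun x : EuclideanSpace ℝ (Fin n) => (‖x‖ ^ 2)⁻¹)
        (Metric.ball 0 1) := by
      rw [integrableOn_fun_norm_addHaar volume (f := fun y : ℝ => (y ^ 2)⁻¹), hdim]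
      have h2 : IntegrableOn (fun y : ℝ => y ^ (n - 3)) (Ioo 0 1) :=
        ((continuous_pow (n - 3)).continuousOn.integrableOn_Icc (a := 0) (b := 1)).mono_set
          Ioo_subset_Icc_self
      refine h2.congr_fun (fun y hy => ?_) measurableSet_Ioo
      have : y ≠ 0 := hy.1.ne'
      simp only [smul_eq_mul]
      rw [show n - 1 = n - 3 + 2 by omega, pow_add]
      field_simp
    have h3 : IntegrableOn (fun x => u x ^ 2 * (‖x‖ ^ 2)⁻¹) (Metric.ball 0 1) := by
      refine h1.bdd_mul (c := C ^ 2) (hu.continuous.pow 2).aestronglyMeasurable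
        (Eventually.of_forall fun x => ?_)
      rw [norm_pow]
      exact pow_le_pow_left₀ (norm_nonneg _) (hC x) 2
    refine ((integrableOn_iff_integrable_of_support_subset ?_).1 h3).congr
      (Eventually.of_forall fun x => (div_eq_mul_inv _ _).symm)
    intro x hx
    by_contra hxb
    rw [mem_ball_zero_iff, not_lt] at hxb
    exact hx (by simp only [hu1 x hxb]; simp)
  obtain ⟨pi1, pe1⟩ := integral_polar volume hwgi
  obtain ⟨pi2, pe2⟩ := integral_polar volume hugi
  obtain ⟨pi3, pe3⟩ := integral_polar volume hhardy
  rw [hdim] at pi1 pe1 pi2 pe2 pi3 pe3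
  rw [pe1, pe2, pe3, ← integral_const_mul, ← integral_sub pi2 (pi3.const_mul _)]
  refine integral_mono pi1 (pi2.sub (pi3.const_mul _)) fun θ => ?_
  have hθ : ‖(θ : EuclideanSpace ℝ (Fin n))‖ = 1 := by simp
  have hnr : ∀ r : ℝ, 0 ≤ r → ‖r • (θ : EuclideanSpace ℝ (Fin n))‖ = r := fun r hr => by
    rw [norm_smul, hθ, mul_one, norm_of_nonneg hr]
  have hda : 1 ≤ ((n : ℝ) - 2) * a := by
    rw [div_le_iff₀ hd] at ha; linarith
  have hR0 : 0 < (((n : ℝ) - 2) * a) ^ (-(1 / ((n : ℝ) - 2))) := by positivity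
  have hR1 : (((n : ℝ) - 2) * a) ^ (-(1 / ((n : ℝ) - 2))) ≤ 1 :=
    rpow_le_one_of_one_le_of_nonpos hda (by rw [neg_nonpos]; positivity)
  have hud : Differentiable ℝ u := hu.differentiable one_ne_zero
  have hwz : ∀ z, (((n : ℝ) - 2) * a) ^ (-(1 / ((n : ℝ) - 2))) < ‖z‖ → gradient w z = 0 := by
    intro z hz
    have : w =ᶠ[𝓝 z] fun _ => 0 := by
      filter_upwards [(isOpen_lt continuous_const continuous_norm).mem_nhds hz] with y hy
      exact radialTransform_eq_zero hd ha0 hu1 (le_of_lt hy)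
    rw [this.gradient_eq]
    exact gradient_const _ _
  have hwz' : ∀ z, (((n : ℝ) - 2) * a) ^ (-(1 / ((n : ℝ) - 2))) ≤ ‖z‖ → gradient w z = 0 := by
    intro z hz
    have h1 : Tendsto (fun t : ℝ => gradient w (t • z)) (𝓝[>] 1) (𝓝 (gradient w z)) := by
      have h2 : Continuous fun t : ℝ => gradient w (t • z) := by fun_prop
      simpa using (h2.tendsto 1).mono_left nhdsWithin_le_nhds
    refine tendsto_nhds_unique h1 (tendsto_const_nhds.congr' ?_)
    filter_upwards [self_mem_nhdsWithin] with t ht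
    refine (hwz _ (hz.trans_lt ?_)).symm
    rw [norm_smul, norm_of_nonneg (zero_le_one.trans (le_of_lt ht))]
    exact lt_mul_of_one_lt_left (hR0.trans_le hz) ht
  have key := integral_ray_gradient_le hn ha0
    (U := fun r => u (r • (θ : EuclideanSpace ℝ (Fin n))))
    (U' := fun r => inner ℝ (gradient u (r • (θ : EuclideanSpace ℝ (Fin n)))) θ)
    (G := fun r => ‖gradient u (r • (θ : EuclideanSpace ℝ (Fin n)))‖ ^ 2)
    (K := fun r => ‖gradient w (r • (θ : EuclideanSpace ℝ (Fin n)))‖ ^ 2)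
    (fun r => by
      have h1 : HasDerivAt (fun r : ℝ => r • (θ : EuclideanSpace ℝ (Fin n))) θ r := by
        simpa using (hasDerivAt_id r).smul_const (θ : EuclideanSpace ℝ (Fin n))
      have h2 := (hud (r • (θ : EuclideanSpace ℝ (Fin n)))).hasGradientAt.hasFDerivAt
      have h3 := HasFDerivAt.comp_hasDerivAt r h2 h1
      exact h3.congr_deriv (by rw [InnerProductSpace.toDual_apply_apply]))
    (by fun_prop) (fun r hr => hu1 _ (by rwa [hnr r (by linarith)])) (by fun_prop)
    (fun r hr => by rw [hg1 _ (by rwa [hnr r (by linarith)])]; simp)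
    (fun ρ => by positivity)
    (fun ρ hρ => by rw [hwz' _ (by rwa [hnr ρ (hR0.le.trans hρ)])]; simp)
    (fun ρ hρ hρ1 => pow_mul_norm_gradient_radialTransform_sq_le hn hρ (hρ1.le.trans hR1) hθ hud)
  refine key.trans (le_of_eq ?_)
  congr 2
  refine setIntegral_congr_fun measurableSet_Ioi fun r hr => ?_
  simp only [hnr r (le_of_lt hr)]

theorem integral_rpow_radialTransform_eq {n : ℕ} (hn : 3 ≤ n) {a : ℝ} (ha : 0 < a)
    {u : EuclideanSpace ℝ (Fin n) → ℝ} (hu : Continuous u) (hus : HasCompactSupport u)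
    (hu1 : ∀ x, 1 ≤ ‖x‖ → u x = 0) (hw : Continuous (radialTransform a ((n : ℝ) - 2) u))
    (hws : HasCompactSupport (radialTransform a ((n : ℝ) - 2) u)) :
    ∫ x, (X1 a ‖x‖) ^ (2 * ((n : ℝ) - 1) / (n - 2)) * |u x| ^ (2 * (n : ℝ) / (n - 2)) =
      ((n : ℝ) - 2) ^ (2 * ((n : ℝ) - 1) / (n - 2)) *
        ∫ z, |radialTransform a ((n : ℝ) - 2) u z| ^ (2 * (n : ℝ) / (n - 2)) := by
  have hn3 : (3 : ℝ) ≤ n := by exact_mod_cast hn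
  have hd : (0 : ℝ) < n - 2 := by linarith
  have : NeZero n := ⟨by omega⟩
  have hq : 0 < 2 * (n : ℝ) / (n - 2) := by positivity
  have hc : 0 < 2 * ((n : ℝ) - 1) / (n - 2) := by
    have : 0 < (n : ℝ) - 1 := by linarith
    positivity
  have hdim : Module.finrank ℝ (EuclideanSpace ℝ (Fin n)) = n := by simp
  have hpi : ∀ f : EuclideanSpace ℝ (Fin n) → ℝ, Continuous f → HasCompactSupport f →
      Integrable fun x => |f x| ^ (2 * (n : ℝ) / (n - 2)) := fun f hf hfs =>
    (hf.abs.rpow_const fun _ => Or.inr hq.le).integrable_of_hasCompactSupport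
      (hfs.comp_left (g := fun t : ℝ => |t| ^ (2 * (n : ℝ) / (n - 2)))
        (by simp [zero_rpow hq.ne']))
  have hXi : Integrable fun x : EuclideanSpace ℝ (Fin n) =>
      (X1 a ‖x‖) ^ (2 * ((n : ℝ) - 1) / (n - 2)) * |u x| ^ (2 * (n : ℝ) / (n - 2)) := by
    refine ((hpi u hu hus).const_mul (a⁻¹ ^ (2 * ((n : ℝ) - 1) / (n - 2)))).mono' ?_ ?_
    · have h1 : Measurable fun x : EuclideanSpace ℝ (Fin n) => X1 a ‖x‖ := by
        unfold X1; fun_prop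
      have h2 := hu.measurable
      exact (by fun_prop : Measurable _).aestronglyMeasurable
    · refine Eventually.of_forall fun x => ?_
      rcases lt_or_ge ‖x‖ 1 with hx | hx
      · have hl : log ‖x‖ ≤ 0 := log_nonpos (norm_nonneg _) hx.le
        have hX0 : 0 ≤ X1 a ‖x‖ := inv_nonneg.2 (by linarith)
        have hX1 : X1 a ‖x‖ ≤ a⁻¹ := inv_anti₀ ha (by linarith)
        rw [norm_of_nonneg (by positivity)]
        gcongr
      · rw [hu1 x hx, abs_zero, zero_rpow hq.ne', mul_zero, mul_zero, norm_zero]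
  rw [(integral_polar volume hXi).2, (integral_polar volume (hpi _ hw hws)).2, hdim,
    ← integral_const_mul]
  refine integral_congr_ae (Eventually.of_forall fun θ => ?_)
  have hθ : ‖(θ : EuclideanSpace ℝ (Fin n))‖ = 1 := by simp
  have hnr : ∀ r : ℝ, 0 ≤ r → ‖r • (θ : EuclideanSpace ℝ (Fin n))‖ = r := fun r hr => by
    rw [norm_smul, hθ, mul_one, norm_of_nonneg hr]
  have hR0 : 0 < (((n : ℝ) - 2) * a) ^ (-(1 / ((n : ℝ) - 2))) := by positivity
  have key := integral_ray_rpow_eq hn ha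
    (U := fun r => u (r • (θ : EuclideanSpace ℝ (Fin n))))
    (W := fun r => radialTransform a ((n : ℝ) - 2) u (r • (θ : EuclideanSpace ℝ (Fin n))))
    (fun r hr => hu1 _ (by rwa [hnr r (by linarith)]))
    (fun ρ hρ => radialTransform_eq_zero hd ha hu1 (by rwa [hnr ρ (hR0.le.trans hρ)]))
    (fun ρ hρ => radialTransform_smul hd hρ hθ u)
  refine Eq.trans ?_ key
  refine setIntegral_congr_fun measurableSet_Ioi fun r hr => ?_
  simp only [hnr r (le_of_lt hr), X1]

end Helpers

theorem stmt0 (n : ℕ) (hn : 3 ≤ n) (a : ℝ) (ha : 1 / ((n : ℝ) - 2) ≤ a)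
    (u : EuclideanSpace ℝ (Fin n) → ℝ) (hu : ContDiff ℝ (⊤ : ℕ∞) u)
    (hcs : HasCompactSupport u)
    (hsupp : tsupport u ⊆ Metric.ball (0 : EuclideanSpace ℝ (Fin n)) 1) :
    (∫ x in Metric.ball (0 : EuclideanSpace ℝ (Fin n)) 1, ‖gradient u x‖ ^ 2)
      ≥ (((n : ℝ) - 2) / 2) ^ 2 *
          (∫ x in Metric.ball (0 : EuclideanSpace ℝ (Fin n)) 1, u x ^ 2 / ‖x‖ ^ 2)
        + ((n : ℝ) - 2) ^ (-(2 * ((n : ℝ) - 1)) / (n : ℝ)) * sobolevConst n *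
          (∫ x in Metric.ball (0 : EuclideanSpace ℝ (Fin n)) 1,
              (X1 a ‖x‖) ^ (2 * ((n : ℝ) - 1) / ((n : ℝ) - 2)) *
                |u x| ^ (2 * (n : ℝ) / ((n : ℝ) - 2)))
            ^ (((n : ℝ) - 2) / (n : ℝ)) := by
  have hn3 : (3 : ℝ) ≤ n := by exact_mod_cast hn
  have hd : (0 : ℝ) < n - 2 := by linarith
  have ha0 : 0 < a := lt_of_lt_of_le (by positivity) ha
  have hq : 0 < 2 * (n : ℝ) / (n - 2) := by positivity
  have hu' : ContDiff ℝ 1 u := hu.of_le (by exact_mod_cast le_top)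
  have hts : ∀ x : EuclideanSpace ℝ (Fin n), 1 ≤ ‖x‖ → x ∉ tsupport u := fun x hx h => by
    have := hsupp h
    rw [mem_ball_zero_iff] at this
    linarith
  have hu1 : ∀ x, 1 ≤ ‖x‖ → u x = 0 := fun x hx => image_eq_zero_of_notMem_tsupport (hts x hx)
  have hg1 : ∀ x, 1 ≤ ‖x‖ → gradient u x = 0 := fun x hx => by
    rw [gradient, fderiv_of_notMem_tsupport ℝ (hts x hx), map_zero]
  have hball : ∀ f : EuclideanSpace ℝ (Fin n) → ℝ, (∀ x, 1 ≤ ‖x‖ → f x = 0) →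
      ∫ x in Metric.ball (0 : EuclideanSpace ℝ (Fin n)) 1, f x = ∫ x, f x := fun f hf =>
    setIntegral_eq_integral_of_forall_compl_eq_zero fun x hx => hf x (by simpa using hx)
  rw [hball _ fun x hx => by rw [hg1 x hx]; simp, hball _ fun x hx => by rw [hu1 x hx]; simp,
    hball _ fun x hx => by rw [hu1 x hx, abs_zero, zero_rpow hq.ne', mul_zero]]
  set w := radialTransform a ((n : ℝ) - 2) u with hwdef
  have hw : ContDiff ℝ 1 w := contDiff_radialTransform hd hu'
  have hws : HasCompactSupport w := HasCompactSupport.intro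
    (isCompact_closedBall 0 ((((n : ℝ) - 2) * a) ^ (-(1 / ((n : ℝ) - 2))))) fun z hz =>
      radialTransform_eq_zero hd ha0 hu1 (by
        rw [mem_closedBall_zero_iff, not_le] at hz
        exact hz.le)
  have h1 := integral_norm_gradient_radialTransform_sq_le hn ha hu' hcs hu1 hg1 hws
  have h2 := sobolev_euclideanSpace hn hw hws
  rw [integral_rpow_radialTransform_eq hn ha0 hu.continuous hcs hu1 hw.continuous hws,
    mul_rpow (by positivity) (integral_nonneg fun z => by positivity), ← rpow_mul hd.le,
    show 2 * ((n : ℝ) - 1) / (n - 2) * ((n - 2) / n) = 2 * (n - 1) / n by field_simp]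
  have h3 : ((n : ℝ) - 2) ^ (-(2 * ((n : ℝ) - 1)) / n) * ((n : ℝ) - 2) ^ (2 * ((n : ℝ) - 1) / n) =
      1 := by
    rw [← rpow_add hd, neg_div, neg_add_cancel, rpow_zero]
  have h4 : ∀ p c s i : ℝ, p * c = 1 → p * s * (c * i) = s * i := fun p c s i h => by
    linear_combination s * i * h
  rw [h4 _ _ _ _ h3]
  linarith
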